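/- Let α ∈ (0,3), μ > 0, ξ ∈ ℝ³, and let A = A_{H,L}(α) > 0 be the constant for which A (∫_{ℝ³} w_{μ,ξ}(y)^{6−α} |x−y|^{−α} dy) w_{μ,ξ}(x)^{5−α} = w_{μ,ξ}(x)⁵ for all x. Suppose h : ℝ³ → ℝ is twice continuously differentiable with ∫_{ℝ³} |∇h|² dx < ∞ and satisfies, for every x ∈ ℝ³, −Δh(x) = A (6−α) (∫_{ℝ³} w_{μ,ξ}(y)^{5−α} h(y) |x−y|^{−α} dy) w_{μ,ξ}(x)^{5−α} + A (5−α) (∫_{ℝ³} w_{μ,ξ}(y)^{6−α} |x−y|^{−α} dy) w_{μ,ξ}(x)^{4−α} h(x). Then h is a real linear combination of the four functions x ↦ ∂w_{μ,ξ}(x)/∂ξ₁, x ↦ ∂w_{μ,ξ}(x)/∂ξ₂, x ↦ ∂w_{μ,ξ}(x)/∂ξ₃, and x ↦ ∂w_{μ,ξ}(x)/∂μ (the partial derivatives of the map (μ,ξ) ↦ w_{μ,ξ}(x)). -/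

import Mathlib

open MeasureTheory Set Filter

noncomputable section

/-- `ℝ³` as a Euclidean space. -/
abbrev E3 : Type := EuclideanSpace ℝ (Fin 3)

/-- The Laplacian of `f : ℝ³ → ℝ`, as the sum of the second partial derivatives. -/
noncomputable def lap (f : E3 → ℝ) (x : E3) : ℝ :=
  ∑ i : Fin 3,
    fderiv ℝ (fun y => fderiv ℝ f y (EuclideanSpace.single i 1)) x (EuclideanSpace.single i 1)

/-- The standard bubble `w_{μ,ξ}(x) = 3^{1/4} (μ/(μ² + |x−ξ|²))^{1/2}`. -/
noncomputable def bubble (μ : ℝ) (ξ x : E3) : ℝ :=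
  (3 : ℝ) ^ ((1 : ℝ)/4) * (μ / (μ ^ 2 + ‖x - ξ‖ ^ 2)) ^ ((1 : ℝ)/2)
/-- The partial derivative of `(μ,ξ) ↦ w_{μ,ξ}(x)` with respect to `ξ_i`
(explicit formula, see context). -/
noncomputable def dBubbleXi (μ : ℝ) (ξ : E3) (i : Fin 3) (x : E3) : ℝ :=
  (3 : ℝ) ^ ((1 : ℝ)/4) * μ ^ ((1 : ℝ)/2) * (x i - ξ i) *
    (μ ^ 2 + ‖x - ξ‖ ^ 2) ^ (-(3 : ℝ)/2)

/-- The partial derivative of `(μ,ξ) ↦ w_{μ,ξ}(x)` with respect to `μ`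
(explicit formula, see context). -/
noncomputable def dBubbleMu (μ : ℝ) (ξ : E3) (x : E3) : ℝ :=
  ((3 : ℝ) ^ ((1 : ℝ)/4) / 2) * (‖x - ξ‖ ^ 2 - μ ^ 2) * μ ^ (-(1 : ℝ)/2) *
    (μ ^ 2 + ‖x - ξ‖ ^ 2) ^ (-(3 : ℝ)/2)

section part1

/-- partial derivative -/
def pd (i : Fin 3) (f : E3 → ℝ) (x : E3) : ℝ := fderiv ℝ f x (EuclideanSpace.single i 1)

lemma lap_eq_pd (f : E3 → ℝ) (x : E3) : lap f x = ∑ i, pd i (pd i f) x := rfl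

lemma pd_eq_of_hasFDerivAt {i : Fin 3} {f : E3 → ℝ} {x : E3} {f' : E3 →L[ℝ] ℝ}
    (hf : HasFDerivAt f f' x) : pd i f x = f' (EuclideanSpace.single i 1) := by
  rw [pd, hf.fderiv]

lemma pd_add {i : Fin 3} {f g : E3 → ℝ} {x : E3} (hf : DifferentiableAt ℝ f x)
    (hg : DifferentiableAt ℝ g x) : pd i (fun y => f y + g y) x = pd i f x + pd i g x := by
  rw [pd_eq_of_hasFDerivAt (hf.hasFDerivAt.fun_add hg.hasFDerivAt)]; rfl

lemma pd_sub {i : Fin 3} {f g : E3 → ℝ} {x : E3} (hf : DifferentiableAt ℝ f x)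
    (hg : DifferentiableAt ℝ g x) : pd i (fun y => f y - g y) x = pd i f x - pd i g x := by
  rw [pd_eq_of_hasFDerivAt (hf.hasFDerivAt.fun_sub hg.hasFDerivAt)]; rfl

lemma pd_mul {i : Fin 3} {f g : E3 → ℝ} {x : E3} (hf : DifferentiableAt ℝ f x)
    (hg : DifferentiableAt ℝ g x) :
    pd i (fun y => f y * g y) x = f x * pd i g x + pd i f x * g x := by
  rw [pd_eq_of_hasFDerivAt (hf.hasFDerivAt.fun_mul hg.hasFDerivAt)]
  simp [pd]; ring

lemma pd_const {i : Fin 3} (c : ℝ) (x : E3) : pd i (fun _ => c) x = 0 := by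
  simp [pd]

lemma pd_const_mul {i : Fin 3} (c : ℝ) {f : E3 → ℝ} {x : E3} (hf : DifferentiableAt ℝ f x) :
    pd i (fun y => c * f y) x = c * pd i f x := by
  rw [pd_mul (by fun_prop) hf, pd_const]; ring

lemma pd_pow {i : Fin 3} (k : ℕ) {f : E3 → ℝ} {x : E3} (hf : DifferentiableAt ℝ f x) :
    pd i (fun y => f y ^ k) x = k * f x ^ (k - 1) * pd i f x := by
  rw [pd_eq_of_hasFDerivAt (hf.hasFDerivAt.pow k)]
  simp [pd]

lemma pd_norm_sq (i : Fin 3) (x : E3) : pd i (fun y => ‖y‖ ^ 2) x = 2 * x i := by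
  rw [pd_eq_of_hasFDerivAt (hasStrictFDerivAt_norm_sq x).hasFDerivAt]
  simp [EuclideanSpace.inner_single_right]

lemma pd_inner (b : E3) (i : Fin 3) (x : E3) : pd i (fun y => inner ℝ b y) x = b i := by
  have : HasFDerivAt (fun y : E3 => (inner ℝ b y : ℝ)) (innerSL ℝ b) x :=
    (innerSL ℝ b).hasFDerivAt
  rw [pd_eq_of_hasFDerivAt this]
  simp [EuclideanSpace.inner_single_right]

lemma coord_eq_inner (i : Fin 3) (x : E3) : x i = inner ℝ (EuclideanSpace.single i (1:ℝ)) x := by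
  simp [EuclideanSpace.inner_single_left]

lemma contDiff_coord (i : Fin 3) {n} : ContDiff ℝ n (fun x : E3 => x i) := by
  fun_prop

lemma pd_coord (i j : Fin 3) (x : E3) : pd i (fun y => y j) x = if i = j then 1 else 0 := by
  have : (fun y : E3 => y j) = fun y => (inner ℝ (EuclideanSpace.single j (1:ℝ)) y : ℝ) := by
    ext y; exact coord_eq_inner j y
  rw [this, pd_inner]; simp [Pi.single_apply]

lemma normsq_eq (x : E3) : ‖x‖ ^ 2 = x 0 ^ 2 + x 1 ^ 2 + x 2 ^ 2 := by
  rw [EuclideanSpace.real_norm_sq_eq, Fin.sum_univ_three]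

lemma inner_eq3 (b x : E3) : (inner ℝ b x : ℝ) = b 0 * x 0 + b 1 * x 1 + b 2 * x 2 := by
  rw [PiLp.inner_apply, Fin.sum_univ_three]; simp; ring

/-- `(1+|x|²)^{-1/2}` -/
def rho (x : E3) : ℝ := (Real.sqrt (1 + ‖x‖ ^ 2))⁻¹

lemma one_add_pos (x : E3) : 0 < 1 + ‖x‖ ^ 2 := by positivity

lemma rho_pos (x : E3) : 0 < rho x := by
  have := one_add_pos x
  unfold rho; positivity

lemma rho_sq (x : E3) : rho x ^ 2 = (1 + ‖x‖ ^ 2)⁻¹ := by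
  rw [rho, inv_pow, Real.sq_sqrt (one_add_pos x).le]

lemma rho_sq_mul (x : E3) : rho x ^ 2 * (1 + ‖x‖ ^ 2) = 1 := by
  rw [rho_sq]; exact inv_mul_cancel₀ (one_add_pos x).ne'

lemma rho_le_one (x : E3) : rho x ≤ 1 := by
  have h1 := rho_sq_mul x
  have h2 := rho_pos x
  nlinarith [mul_nonneg (sq_nonneg (rho x)) (sq_nonneg ‖x‖)]

lemma rho_norm_le (x : E3) : rho x * ‖x‖ ≤ 1 := by
  have h1 := rho_sq_mul x
  have h2 := rho_pos x
  have : (rho x * ‖x‖)^2 ≤ 1 := by nlinarith [sq_nonneg (rho x)]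
  exact (abs_le_one_iff_mul_self_le_one.mpr (by nlinarith)) |> (le_of_abs_le)

lemma contDiff_rho {n} : ContDiff ℝ n rho := by
  unfold rho
  refine ContDiff.inv (ContDiff.sqrt (contDiff_const.add (contDiff_norm_sq ℝ)) ?_) ?_
  · intro x; exact (one_add_pos x).ne'
  · intro x; have := one_add_pos x; positivity

lemma diff_rho (x : E3) : DifferentiableAt ℝ rho x :=
  (contDiff_rho (n := 1)).differentiable (by norm_num) x

lemma continuous_rho : Continuous rho := (contDiff_rho (n := 0)).continuous

lemma pd_rho (i : Fin 3) (x : E3) : pd i rho x = - rho x ^ 3 * x i := by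
  have h1 : pd i (fun y => rho y ^ 2 * (1 + ‖y‖ ^ 2)) x = 0 := by
    rw [show (fun y => rho y ^ 2 * (1 + ‖y‖ ^ 2)) = fun _ => (1:ℝ) from funext rho_sq_mul]
    exact pd_const 1 x
  have hd := diff_rho x
  have hn : DifferentiableAt ℝ (fun y : E3 => ‖y‖ ^ 2) x :=
    ((contDiff_norm_sq ℝ (n := 1)).differentiable (by norm_num)) x
  rw [pd_mul (by fun_prop) (by fun_prop), pd_pow 2 hd,
    pd_add (differentiableAt_const _) hn, pd_const, pd_norm_sq] at h1
  have h2 := rho_sq_mul x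
  have h3 := rho_pos x
  have : pd i rho x * (2 * rho x * (1 + ‖x‖^2)) = - rho x ^ 3 * x i * (2 * rho x * (1 + ‖x‖^2)) := by
    simp at h1
    linear_combination h1 + 2 * rho x ^2 * x i * h2
  have hne : (2 * rho x * (1 + ‖x‖^2)) ≠ 0 := by have := one_add_pos x; positivity
  exact mul_right_cancel₀ hne this

/-- linear functions on the sphere, in stereographic coordinates -/
def sg (a : ℝ) (b : E3) (x : E3) : ℝ := a + 2 * rho x ^ 2 * (inner ℝ b x - a)

lemma contDiff_innerL (b : E3) {n} : ContDiff ℝ n (fun y : E3 => (inner ℝ b y : ℝ)) :=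
  contDiff_const.inner ℝ contDiff_id

lemma diff_inner (b x : E3) : DifferentiableAt ℝ (fun y : E3 => (inner ℝ b y : ℝ)) x :=
  (contDiff_innerL b (n := 1)).differentiable (by norm_num) x

lemma contDiff_sg (a : ℝ) (b : E3) {n} : ContDiff ℝ n (sg a b) := by
  unfold sg
  have := contDiff_rho (n := n)
  have := contDiff_innerL b (n := n)
  fun_prop

lemma diff_sg (a : ℝ) (b x : E3) : DifferentiableAt ℝ (sg a b) x :=
  (contDiff_sg a b (n := 1)).differentiable (by norm_num) x

lemma pd_sg (a : ℝ) (b : E3) (i : Fin 3) (x : E3) :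
    pd i (sg a b) x = -4 * rho x ^ 4 * x i * (inner ℝ b x - a) + 2 * rho x ^ 2 * b i := by
  have hd := diff_rho x
  have hi := diff_inner b x
  unfold sg
  rw [pd_add (by fun_prop) (by fun_prop), pd_const, pd_mul (by fun_prop) (by fun_prop),
    pd_const_mul _ (by fun_prop), pd_pow 2 hd, pd_sub hi (by fun_prop), pd_inner, pd_const, pd_rho]
  simp; ring

lemma lap_sg (a : ℝ) (b x : E3) : lap (sg a b) x =
    16 * rho x ^ 6 * ‖x‖^2 * (inner ℝ b x - a) - 12 * rho x ^ 4 * (inner ℝ b x - a)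
      - 8 * rho x ^ 4 * inner ℝ b x := by
  have hd := diff_rho x
  have hi := diff_inner b x
  have key : ∀ i, pd i (pd i (sg a b)) x = 16 * rho x ^ 6 * x i ^ 2 * (inner ℝ b x - a)
      - 4 * rho x ^ 4 * (inner ℝ b x - a) - 8 * rho x ^ 4 * (b i * x i) := by
    intro i
    rw [show pd i (sg a b) = _ from funext (pd_sg a b i)]
    rw [pd_add (by fun_prop) (by fun_prop), pd_mul (by fun_prop) (by fun_prop),
      pd_mul (by fun_prop) (by fun_prop), pd_mul (by fun_prop) (by fun_prop), pd_const,
      pd_mul (by fun_prop) (by fun_prop), pd_const_mul _ (by fun_prop), pd_pow 2 hd, pd_pow 4 hd,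
      pd_sub hi (by fun_prop), pd_inner, pd_const, pd_rho, pd_coord, pd_const]
    simp; ring
  rw [lap_eq_pd]; simp_rw [key]
  rw [Fin.sum_univ_three, normsq_eq, inner_eq3]; ring

lemma grad_sg_sq (a : ℝ) (b x : E3) : ∑ i, pd i (sg a b) x ^ 2
    = 4 * rho x ^ 4 * (a ^ 2 + ‖b‖ ^ 2 - sg a b x ^ 2) := by
  have h := rho_sq_mul x
  simp_rw [pd_sg]
  have e : ∑ i, (-4 * rho x ^ 4 * x i * (inner ℝ b x - a) + 2 * rho x ^ 2 * b i) ^ 2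
    = 16 * rho x ^ 8 * ‖x‖^2 * (inner ℝ b x - a)^2
      - 16 * rho x ^ 6 * inner ℝ b x * (inner ℝ b x - a) + 4 * rho x ^ 4 * ‖b‖^2 := by
    rw [Fin.sum_univ_three, normsq_eq, normsq_eq, inner_eq3]; ring
  rw [e, sg]
  linear_combination 16 * rho x ^ 6 * (inner ℝ b x - a)^2 * h

lemma pd_contDiff {f : E3 → ℝ} {n : ℕ} (hf : ContDiff ℝ (n+1) f) (i : Fin 3) :
    ContDiff ℝ n (pd i f) := by
  unfold pd
  exact (hf.fderiv_right (by norm_num)).clm_apply contDiff_const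

lemma lap_mul {f g : E3 → ℝ} (hf : ContDiff ℝ 2 f) (hg : ContDiff ℝ 2 g) (x : E3) :
    lap (fun y => f y * g y) x = f x * lap g x + lap f x * g x + 2 * ∑ i, pd i f x * pd i g x := by
  have df : Differentiable ℝ f := hf.differentiable (by norm_num)
  have dg : Differentiable ℝ g := hg.differentiable (by norm_num)
  have dpf : ∀ i, Differentiable ℝ (pd i f) := fun i =>
    (pd_contDiff (n := 1) (by exact_mod_cast hf) i).differentiable (by norm_num)
  have dpg : ∀ i, Differentiable ℝ (pd i g) := fun i =>
    (pd_contDiff (n := 1) (by exact_mod_cast hg) i).differentiable (by norm_num)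
  simp only [lap_eq_pd, Finset.mul_sum, Finset.sum_mul]
  rw [← Finset.sum_add_distrib, ← Finset.sum_add_distrib]
  refine Finset.sum_congr rfl fun i _ => ?_
  rw [show pd i (fun y => f y * g y) = fun y => f y * pd i g y + pd i f y * g y from
    funext fun y => pd_mul (df y) (dg y)]
  rw [pd_add ((df x).fun_mul (dpg i x)) ((dpf i x).fun_mul (dg x)), pd_mul (df x) (dpg i x),
    pd_mul (dpf i x) (dg x)]
  ring

lemma lap_pow {g : E3 → ℝ} (hg : ContDiff ℝ 2 g) (k : ℕ) (x : E3) :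
    lap (fun y => g y ^ k) x = k * g x ^ (k-1) * lap g x
      + k * (k - 1) * g x ^ (k - 2) * ∑ i, pd i g x ^ 2 := by
  have dg : Differentiable ℝ g := hg.differentiable (by norm_num)
  have dpg : ∀ i, Differentiable ℝ (pd i g) := fun i =>
    (pd_contDiff (n := 1) (by exact_mod_cast hg) i).differentiable (by norm_num)
  simp only [lap_eq_pd, Finset.mul_sum]
  rw [← Finset.sum_add_distrib]
  refine Finset.sum_congr rfl fun i _ => ?_
  rw [show pd i (fun y => g y ^ k) = fun y => k * g y ^ (k-1) * pd i g y from
    funext fun y => pd_pow k (dg y)]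
  rw [pd_mul (((dg x).fun_pow _).const_mul _) (dpg i x), pd_const_mul _ ((dg x).fun_pow _),
    pd_pow _ (dg x)]
  rcases k with _ | k
  · simp
  · simp only [Nat.add_sub_cancel, Nat.cast_add, Nat.cast_one, show k + 1 - 2 = k - 1 by omega]; ring

lemma lap_add {f g : E3 → ℝ} (hf : ContDiff ℝ 2 f) (hg : ContDiff ℝ 2 g) (x : E3) :
    lap (fun y => f y + g y) x = lap f x + lap g x := by
  have df : Differentiable ℝ f := hf.differentiable (by norm_num)
  have dg : Differentiable ℝ g := hg.differentiable (by norm_num)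
  have dpf : ∀ i, Differentiable ℝ (pd i f) := fun i =>
    (pd_contDiff (n := 1) (by exact_mod_cast hf) i).differentiable (by norm_num)
  have dpg : ∀ i, Differentiable ℝ (pd i g) := fun i =>
    (pd_contDiff (n := 1) (by exact_mod_cast hg) i).differentiable (by norm_num)
  simp only [lap_eq_pd]
  rw [← Finset.sum_add_distrib]
  refine Finset.sum_congr rfl fun i _ => ?_
  rw [show pd i (fun y => f y + g y) = fun y => pd i f y + pd i g y from
    funext fun y => pd_add (df y) (dg y)]
  rw [pd_add (dpf i x) (dpg i x)]

lemma lap_const_mul {f : E3 → ℝ} (c : ℝ) (hf : ContDiff ℝ 2 f) (x : E3) :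
    lap (fun y => c * f y) x = c * lap f x := by
  have : lap (fun _ => c) x = 0 := by
    simp only [lap_eq_pd]
    refine Finset.sum_eq_zero fun i _ => ?_
    rw [show pd i (fun _ => c) = fun _ => 0 from funext fun y => pd_const c y, pd_const]
  rw [lap_mul contDiff_const hf, this]
  simp [pd_const]

lemma lap_rho (x : E3) : lap rho x = -3 * rho x ^ 5 := by
  have hd := diff_rho x
  have h := rho_sq_mul x
  have key : ∀ i, pd i (pd i rho) x = 3 * rho x ^ 5 * x i ^ 2 - rho x ^ 3 := by
    intro i
    rw [show pd i rho = _ from funext (pd_rho i)]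
    rw [show (fun x => -rho x ^ 3 * x i) = fun x => (-1) * (rho x ^ 3 * x i) from by
      funext x; ring]
    rw [pd_const_mul _ (by fun_prop), pd_mul (by fun_prop) (by fun_prop), pd_pow 3 hd, pd_rho,
      pd_coord]
    simp; ring
  rw [lap_eq_pd]; simp_rw [key]
  have e := normsq_eq x
  rw [Fin.sum_univ_three]
  rw [e] at h
  linear_combination 3 * rho x ^ 3 * h

/-- the key eigenvalue computation -/
lemma lap_rho_sg_pow (a : ℝ) (b x : E3) (k : ℕ) :
    - lap (fun y => rho y * sg a b y ^ k) x = rho x ^ 5 *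
      ((3 + 4 * k * (k + 2)) * sg a b x ^ k
        - 4 * k * (k - 1) * (a ^ 2 + ‖b‖ ^ 2) * sg a b x ^ (k - 2)) := by
  have h := rho_sq_mul x
  rw [lap_mul contDiff_rho ((contDiff_sg a b).pow k), lap_pow (contDiff_sg a b), lap_rho,
    grad_sg_sq, lap_sg]
  simp_rw [pd_pow k (diff_sg a b x), pd_rho, pd_sg]
  have e : ∑ i, -rho x ^ 3 * x i * (k * sg a b x ^ (k - 1) *
        (-4 * rho x ^ 4 * x i * (inner ℝ b x - a) + 2 * rho x ^ 2 * b i)) =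
      k * sg a b x ^ (k - 1) * (4 * rho x ^ 7 * ‖x‖^2 * (inner ℝ b x - a)
        - 2 * rho x ^ 5 * inner ℝ b x) := by
    rw [Fin.sum_univ_three, normsq_eq, inner_eq3]; ring
  rw [e]
  rcases k with _ | k
  · simp; ring
  rcases k with _ | k
  · simp
    rw [sg]
    linear_combination (-24 * rho x ^5 * (inner ℝ b x - a)) * h
  · simp only [Nat.add_sub_cancel, Nat.cast_add, Nat.cast_one, pow_succ (sg a b x) k,
      show k + 1 + 1 - 2 = k by omega, pow_succ (sg a b x) (k+1), show k + 1 + 1 - 1 = k+1 by omega]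
    have hs : sg a b x = a + 2 * rho x ^ 2 * (inner ℝ b x - a) := rfl
    generalize inner ℝ b x = β at *
    generalize hS : sg a b x ^ k = S
    generalize sg a b x = s at *
    subst hs
    generalize ‖x‖^2 = N at *
    generalize ‖b‖^2 = b2 at *
    linear_combination (-24 * rho x ^5 * (β - a) * (k+1+1) * S * (a + 2 * rho x ^ 2 * (β - a))) * h

end part1

section part2

lemma integrable_rho4 : Integrable (fun x : E3 => rho x ^ 4) := by
  have := integrable_rpow_neg_one_add_norm_sq (E := E3) (μ := volume) (r := 4) (by simp; norm_num)
  refine this.congr (ae_of_all _ fun x => ?_)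
  have h := one_add_pos x
  show (1 + ‖x‖^2) ^ (-(4:ℝ)/2) = rho x ^ 4
  rw [show rho x ^ 4 = (rho x ^ 2)^2 by ring, rho_sq, show -(4:ℝ)/2 = -(2:ℕ) by norm_num,
    Real.rpow_neg h.le, Real.rpow_natCast, inv_pow]

lemma integrable_of_le_rho4 {f : E3 → ℝ} (hf : Continuous f) (C : ℝ)
    (h : ∀ x, |f x| ≤ C * rho x ^ 4) : Integrable f :=
  (integrable_rho4.const_mul C).mono' hf.aestronglyMeasurable (ae_of_all _ h)

lemma integral_pd_zero {f : E3 → ℝ} (hf : ContDiff ℝ 1 f) (hc : HasCompactSupport f) (i : Fin 3) :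
    Integrable (pd i f) ∧ ∫ x, pd i f x = 0 := by
  have hcont : Continuous (pd i f) := (pd_contDiff (n := 0) (by simpa using hf) i).continuous
  have hc' : HasCompactSupport (pd i f) := by
    unfold pd
    exact hc.fderiv_apply (𝕜 := ℝ) _
  have hi : Integrable (pd i f) := hcont.integrable_of_hasCompactSupport hc'
  refine ⟨hi, ?_⟩
  have := integral_mul_fderiv_eq_neg_fderiv_mul_of_integrable (𝕜 := ℝ) (f := f) (g := fun _ : E3 => (1:ℝ))
    (v := EuclideanSpace.single i 1) (μ := volume) (by simp only [mul_one]; exact hi) (by simp)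
    (by simpa using hf.continuous.integrable_of_hasCompactSupport hc)
    (fun x _ => (hf.differentiable (by norm_num)) x) (fun x _ => differentiableAt_const _)
  simp at this
  exact this

lemma hasDerivAt_max_sq (t : ℝ) : HasDerivAt (fun t : ℝ => (max 0 t)^2) (2 * max 0 t) t := by
  rcases lt_trichotomy t 0 with ht | ht | ht
  · rw [max_eq_left ht.le, mul_zero]
    refine (hasDerivAt_const t (0:ℝ)).congr_of_eventuallyEq ?_
    filter_upwards [gt_mem_nhds ht] with s hs
    simp [max_eq_left hs.le]
  · subst ht
    rw [hasDerivAt_iff_isLittleO]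
    simp
    have : (fun x : ℝ => (max 0 x)^2) =O[nhds 0] fun x => x^2 := by
      refine Asymptotics.IsBigO.of_bound 1 (Eventually.of_forall fun x => ?_)
      rw [one_mul, norm_pow, norm_pow]
      gcongr
      rcases le_total 0 x with h | h <;> simp [h]
    exact this.trans_isLittleO (by simpa using Asymptotics.isLittleO_pow_id (𝕜 := ℝ) one_lt_two)
  · rw [max_eq_right ht.le]
    have := hasDerivAt_pow 2 t
    simp at this
    refine this.congr_of_eventuallyEq ?_
    filter_upwards [lt_mem_nhds ht] with s hs
    simp [max_eq_right hs.le]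

/-- a `C¹` cutoff -/
def chi (R : ℝ) (x : E3) : ℝ := (max 0 (1 - ‖x‖ ^ 2 / R ^ 2)) ^ 2

lemma contDiff_max_sq : ContDiff ℝ 1 (fun t : ℝ => (max 0 t)^2) := by
  rw [contDiff_one_iff_deriv]
  refine ⟨fun t => (hasDerivAt_max_sq t).differentiableAt, ?_⟩
  rw [show deriv (fun t : ℝ => (max 0 t)^2) = fun t => 2 * max 0 t from
    funext fun t => (hasDerivAt_max_sq t).deriv]
  fun_prop

lemma contDiff_chi (R : ℝ) : ContDiff ℝ 1 (chi R) := by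
  unfold chi
  exact contDiff_max_sq.comp (g := fun t : ℝ => (max 0 t)^2)
    (contDiff_const.sub ((contDiff_norm_sq ℝ).div_const _))

lemma pd_chi (R : ℝ) (i : Fin 3) (x : E3) :
    pd i (chi R) x = - (4 / R ^ 2) * x i * max 0 (1 - ‖x‖ ^ 2 / R ^ 2) := by
  have h1 : HasFDerivAt (fun y : E3 => 1 - ‖y‖ ^ 2 / R ^ 2)
      (-((R^2)⁻¹ • (2 • (innerSL ℝ x)))) x := by
    have := ((hasStrictFDerivAt_norm_sq x).hasFDerivAt.const_mul ((R^2)⁻¹)).const_sub 1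
    refine this.congr_of_eventuallyEq (Eventually.of_forall fun y => ?_)
    simp only [div_eq_inv_mul]
  have h2 := (hasDerivAt_max_sq (1 - ‖x‖ ^ 2 / R ^ 2)).comp_hasFDerivAt x h1
  have h3 : HasFDerivAt (chi R) _ x := h2
  rw [pd_eq_of_hasFDerivAt h3]
  simp [EuclideanSpace.inner_single_right]
  ring

lemma chi_nonneg (R : ℝ) (x : E3) : 0 ≤ chi R x := by unfold chi; positivity

lemma chi_le_one (R : ℝ) (x : E3) : chi R x ≤ 1 := by
  unfold chi
  have : max 0 (1 - ‖x‖ ^ 2 / R ^ 2) ≤ 1 := max_le (by norm_num) (by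
    have : 0 ≤ ‖x‖ ^ 2 / R ^ 2 := by positivity
    linarith)
  exact pow_le_one₀ (le_max_left _ _) this

lemma chi_compact {R : ℝ} (hR : 0 < R) : HasCompactSupport (chi R) := by
  refine HasCompactSupport.intro (isCompact_closedBall (0 : E3) R) fun x hx => ?_
  simp at hx
  unfold chi
  rw [max_eq_left, zero_pow (by norm_num)]
  have : 1 ≤ ‖x‖ ^ 2 / R ^ 2 := by
    rw [one_le_div (by positivity)]
    gcongr
  linarith

lemma tendsto_max_one (x : E3) :
    Tendsto (fun n : ℕ => max 0 (1 - ‖x‖ ^ 2 / ((n:ℝ) + 1) ^ 2)) atTop (nhds 1) := by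
  have h0 : Tendsto (fun n : ℕ => ((n:ℝ) + 1) ^ 2) atTop atTop :=
    (tendsto_pow_atTop two_ne_zero).comp
      (tendsto_atTop_add_const_right _ _ tendsto_natCast_atTop_atTop)
  have h1 : Tendsto (fun n : ℕ => 1 - ‖x‖ ^ 2 / ((n:ℝ) + 1) ^ 2) atTop (nhds (1 - 0)) :=
    tendsto_const_nhds.sub (h0.const_div_atTop _)
  have h2 := (tendsto_const_nhds (x := (0:ℝ))).max h1
  simpa using h2

lemma tendsto_chi (x : E3) : Tendsto (fun n : ℕ => chi ((n:ℝ) + 1) x) atTop (nhds 1) := by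
  simpa [chi] using (tendsto_max_one x).pow 2

lemma tendsto_pd_chi (i : Fin 3) (x : E3) :
    Tendsto (fun n : ℕ => pd i (chi ((n:ℝ) + 1)) x) atTop (nhds 0) := by
  simp_rw [pd_chi]
  have h0 : Tendsto (fun n : ℕ => ((n:ℝ) + 1) ^ 2) atTop atTop :=
    (tendsto_pow_atTop two_ne_zero).comp
      (tendsto_atTop_add_const_right _ _ tendsto_natCast_atTop_atTop)
  have := (((h0.const_div_atTop 4).neg).mul_const (x i)).mul (tendsto_max_one x)
  simpa using this

lemma abs_coord_le (x : E3) (i : Fin 3) : |x i| ≤ ‖x‖ := by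
  simpa using PiLp.norm_apply_le x i

lemma abs_pd_chi_le {R : ℝ} (hR : 1 ≤ R) (i : Fin 3) (x : E3) :
    |pd i (chi R) x| ≤ 8 * rho x := by
  have hp := rho_pos x
  have hR0 : 0 < R := by linarith
  rw [pd_chi]
  rcases le_total R ‖x‖ with h | h
  · have : 1 ≤ ‖x‖ ^ 2 / R ^ 2 := by
      rw [one_le_div (by positivity)]; gcongr
    rw [max_eq_left (by linarith)]; simp; positivity
  · have h1 : |max 0 (1 - ‖x‖ ^ 2 / R ^ 2)| ≤ 1 := by
      rw [abs_of_nonneg (le_max_left _ _)]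
      refine max_le (by norm_num) ?_
      have : 0 ≤ ‖x‖ ^ 2 / R ^ 2 := by positivity
      linarith
    have h2 : |x i| ≤ 2 * R ^ 2 * rho x := by
      have hx := abs_coord_le x i
      have hr := rho_sq_mul x
      refine hx.trans (h.trans ?_)
      refine le_of_sq_le_sq ?_ (by positivity)
      have h5 : 1 ≤ rho x ^ 2 * (2 * R^2) := by
        rw [← hr]; gcongr; nlinarith [norm_nonneg x]
      nlinarith [sq_nonneg R, mul_le_mul_of_nonneg_left h5 (sq_nonneg R)]
    rw [abs_mul, abs_mul, abs_neg, abs_of_nonneg (by positivity : 0 ≤ 4 / R^2)]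
    calc 4 / R^2 * |x i| * |max 0 (1 - ‖x‖ ^ 2 / R ^ 2)| ≤ 4 / R^2 * (2 * R ^ 2 * rho x) * 1 := by
          gcongr
      _ = 8 * rho x := by field_simp; ring

lemma integral_div_zero (F : Fin 3 → E3 → ℝ) (hF : ∀ i, ContDiff ℝ 1 (F i))
    (h1 : ∀ i, Integrable (fun x => rho x * F i x))
    (h2 : Integrable (fun x => ∑ i, pd i (F i) x)) : ∫ x, ∑ i, pd i (F i) x = 0 := by
  have dF : ∀ i, Differentiable ℝ (F i) := fun i => (hF i).differentiable (by norm_num)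
  have hdc : ∀ R, Differentiable ℝ (chi R) := fun R => (contDiff_chi R).differentiable (by norm_num)
  have cpd : ∀ R i, Continuous (pd i (chi R)) := fun R i =>
    (pd_contDiff (n := 0) (by simpa using contDiff_chi R) i).continuous
  have cpF : ∀ i, Continuous (pd i (F i)) := fun i =>
    (pd_contDiff (n := 0) (by simpa using hF i) i).continuous
  have key : ∀ n : ℕ, ∫ x, (chi ((n:ℝ)+1) x * ∑ i, pd i (F i) x)
      = - ∫ x, ∑ i, pd i (chi ((n:ℝ)+1)) x * F i x := by
    intro n
    have hpos : (0:ℝ) < (n:ℝ) + 1 := by positivity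
    have e : ∀ x, ∑ i, pd i (fun y => chi ((n:ℝ)+1) y * F i y) x =
        chi ((n:ℝ)+1) x * ∑ i, pd i (F i) x + ∑ i, pd i (chi ((n:ℝ)+1)) x * F i x := by
      intro x
      rw [Finset.mul_sum, ← Finset.sum_add_distrib]
      exact Finset.sum_congr rfl fun i _ => pd_mul (hdc _ x) (dF i x)
    have hz := fun i => integral_pd_zero ((contDiff_chi ((n:ℝ)+1)).mul (hF i))
      ((chi_compact hpos).mul_right (f' := F i)) i
    have hz2 : ∫ x, ∑ i, pd i (fun y => chi ((n:ℝ)+1) y * F i y) x = 0 := by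
      rw [integral_finsetSum _ fun i _ => (hz i).1]
      exact Finset.sum_eq_zero fun i _ => (hz i).2
    have i1 : Integrable (fun x => chi ((n:ℝ)+1) x * ∑ i, pd i (F i) x) := by
      refine h2.norm.mono' ((contDiff_chi _).continuous.aestronglyMeasurable.mul
        h2.aestronglyMeasurable) (ae_of_all _ fun x => ?_)
      rw [norm_mul]
      refine mul_le_of_le_one_left (norm_nonneg _) ?_
      rw [Real.norm_of_nonneg (chi_nonneg _ _)]; exact chi_le_one _ _
    have i2 : Integrable (fun x => ∑ i, pd i (chi ((n:ℝ)+1)) x * F i x) := by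
      refine integrable_finsetSum _ fun i _ => ?_
      have hc : HasCompactSupport (pd i (chi ((n:ℝ)+1))) := (chi_compact hpos).fderiv_apply (𝕜 := ℝ) _
      exact ((cpd _ i).mul (hF i).continuous).integrable_of_hasCompactSupport (hc.mul_right)
    simp_rw [e] at hz2
    rw [integral_add i1 i2] at hz2
    linarith
  have t1 : Tendsto (fun n : ℕ => ∫ x, (chi ((n:ℝ)+1) x * ∑ i, pd i (F i) x)) atTop
      (nhds (∫ x, ∑ i, pd i (F i) x)) := by
    refine tendsto_integral_of_dominated_convergence (fun x => ‖∑ i, pd i (F i) x‖)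
      (fun n => (contDiff_chi _).continuous.aestronglyMeasurable.mul h2.aestronglyMeasurable)
      h2.norm (fun n => ae_of_all _ fun x => ?_) (ae_of_all _ fun x => ?_)
    · rw [norm_mul]
      refine mul_le_of_le_one_left (norm_nonneg _) ?_
      rw [Real.norm_of_nonneg (chi_nonneg _ _)]; exact chi_le_one _ _
    · simpa using (tendsto_chi x).mul_const (∑ i, pd i (F i) x)
  have t2 : Tendsto (fun n : ℕ => ∫ x, ∑ i, pd i (chi ((n:ℝ)+1)) x * F i x) atTop
      (nhds (∫ x : E3, (0:ℝ))) := by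
    refine tendsto_integral_of_dominated_convergence (fun x => ∑ i, 8 * ‖rho x * F i x‖)
      (fun n => ?_) (integrable_finsetSum _ fun i _ => (h1 i).norm.const_mul 8)
      (fun n => ae_of_all _ fun x => ?_) (ae_of_all _ fun x => ?_)
    · exact Continuous.aestronglyMeasurable
        (continuous_finsetSum _ fun i _ => (cpd _ i).mul (hF i).continuous)
    · refine (norm_sum_le _ _).trans (Finset.sum_le_sum fun i _ => ?_)
      rw [norm_mul, norm_mul, ← mul_assoc]
      gcongr
      rw [Real.norm_of_nonneg (rho_pos x).le]
      exact abs_pd_chi_le (by simp) i x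
    · rw [show (0:ℝ) = ∑ i : Fin 3, 0 * F i x by simp]
      exact tendsto_finsetSum _ fun i _ => (tendsto_pd_chi i x).mul_const _
  simp_rw [key] at t1
  have := tendsto_nhds_unique t1 t2.neg
  simpa using this

/-- Green identity -/
lemma green {f g : E3 → ℝ} (hf : ContDiff ℝ 2 f) (hg : ContDiff ℝ 2 g)
    (h1 : ∀ i, Integrable (fun x => rho x * (f x * pd i g x)))
    (h2 : ∀ i, Integrable (fun x => rho x * (g x * pd i f x)))
    (h3 : Integrable (fun x => f x * lap g x)) (h4 : Integrable (fun x => g x * lap f x)) :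
    ∫ x, f x * lap g x = ∫ x, g x * lap f x := by
  have df : Differentiable ℝ f := hf.differentiable (by norm_num)
  have dg : Differentiable ℝ g := hg.differentiable (by norm_num)
  have cpf : ∀ i, ContDiff ℝ 1 (pd i f) := fun i => pd_contDiff (n := 1) (by exact_mod_cast hf) i
  have cpg : ∀ i, ContDiff ℝ 1 (pd i g) := fun i => pd_contDiff (n := 1) (by exact_mod_cast hg) i
  have e : ∀ x, ∑ i, pd i (fun y => f y * pd i g y - g y * pd i f y) x =
      f x * lap g x - g x * lap f x := by
    intro x
    rw [lap_eq_pd, lap_eq_pd, Finset.mul_sum, Finset.mul_sum, ← Finset.sum_sub_distrib]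
    refine Finset.sum_congr rfl fun i _ => ?_
    have a1 := (cpf i).differentiable (by norm_num) x
    have a2 := (cpg i).differentiable (by norm_num) x
    rw [pd_sub ((df x).fun_mul a2) ((dg x).fun_mul a1),
      pd_mul (df x) a2, pd_mul (dg x) a1]
    ring
  have := integral_div_zero (fun i y => f y * pd i g y - g y * pd i f y)
    (fun i => ((hf.of_le (by norm_num)).mul (cpg i)).sub ((hg.of_le (by norm_num)).mul (cpf i)))
    (fun i => by simp only [mul_sub]; exact (h1 i).sub (h2 i))
    (by simp_rw [e]; exact h3.sub h4)
  simp_rw [e] at this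
  rw [integral_sub h3 h4] at this
  linarith

set_option maxHeartbeats 1000000 in
/-- Hardy inequality -/
lemma hardy {h : E3 → ℝ} (hh : ContDiff ℝ 1 h)
    (hfin : Integrable (fun x : E3 => ‖fderiv ℝ h x‖ ^ 2)) :
    Integrable (fun x => rho x ^ 4 * h x ^ 2) := by
  have dh : Differentiable ℝ h := hh.differentiable (by norm_num)
  have hdc : ∀ R, Differentiable ℝ (chi R) := fun R => (contDiff_chi R).differentiable (by norm_num)
  have hc4 : Continuous (fun x => rho x ^ 4 * h x ^ 2) := (continuous_rho.pow 4).mul (hh.continuous.pow 2)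
  have hball : Integrable (indicator (Metric.closedBall (0:E3) 3) (fun x => 4 * h x ^ 2)) := by
    refine IntegrableOn.integrable_indicator ?_ measurableSet_closedBall
    exact (Continuous.continuousOn (by have := hh.continuous; fun_prop)).integrableOn_compact
      (isCompact_closedBall _ _)
  have drho : Differentiable ℝ rho := diff_rho
  have main : ∀ R : ℝ, 1 ≤ R → ∫ x, chi R x * (rho x ^ 4 * h x ^ 2) ≤
      4 * ((∫ x, indicator (Metric.closedBall (0:E3) 3) (fun x => 4 * h x ^ 2) x)
        + ∫ x, 36 * ‖fderiv ℝ h x‖ ^ 2) := by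
    intro R hR
    have hR0 : 0 < R := by linarith
    have cchi := contDiff_chi R
    have h_int1 : Integrable (fun x => chi R x * (rho x ^ 4 * h x ^ 2)) :=
      (cchi.continuous.mul hc4).integrable_of_hasCompactSupport ((chi_compact hR0).mul_right)
    have hz := fun i : Fin 3 => integral_pd_zero (f := fun y => chi R y * (h y ^ 2 * (rho y ^ 4 * y i)))
      (cchi.mul ((hh.pow 2).mul ((contDiff_rho.pow 4).mul (contDiff_coord i))))
      ((chi_compact hR0).mul_right) i
    have hz2 : ∫ x, ∑ i, pd i (fun y => chi R y * (h y ^ 2 * (rho y ^ 4 * y i))) x = 0 := by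
      rw [integral_finsetSum _ fun i _ => (hz i).1]
      exact Finset.sum_eq_zero fun i _ => (hz i).2
    have hi2 : Integrable (fun x => ∑ i, pd i (fun y => chi R y * (h y ^ 2 * (rho y ^ 4 * y i))) x) :=
      integrable_finsetSum _ fun i _ => (hz i).1
    have pw : ∀ x, ∑ i, pd i (fun y => chi R y * (h y ^ 2 * (rho y ^ 4 * y i))) x ≤
        -(1/4) * (chi R x * (rho x ^ 4 * h x ^ 2)) +
          (indicator (Metric.closedBall (0:E3) 3) (fun x => 4 * h x ^ 2) x
            + 36 * ‖fderiv ℝ h x‖ ^ 2) := by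
      intro x
      have e : ∀ i, pd i (fun y => chi R y * (h y ^ 2 * (rho y ^ 4 * y i))) x =
          chi R x * (2 * h x * rho x ^ 4 * (x i * pd i h x)
            + h x ^ 2 * (rho x ^ 4 - 4 * rho x ^ 6 * x i ^ 2))
          - (4 / R^2 * max 0 (1 - ‖x‖ ^ 2 / R ^ 2) * h x ^ 2 * rho x ^ 4) * x i ^ 2 := by
        intro i
        have a1 := hdc R x
        have a2 := dh x
        have a3 := drho x
        rw [pd_mul (by fun_prop) (by fun_prop), pd_mul (by fun_prop) (by fun_prop),
          pd_mul (by fun_prop) (by fun_prop), pd_pow _ a2, pd_pow _ a3, pd_rho, pd_chi, pd_coord]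
        simp; ring
      have s2 : ∑ i, x i ^ 2 = ‖x‖ ^ 2 := by rw [normsq_eq, Fin.sum_univ_three]
      have hP : |∑ i, x i * pd i h x| ≤ 3 * (‖x‖ * ‖fderiv ℝ h x‖) := by
        refine (Finset.abs_sum_le_sum_abs _ _).trans ?_
        refine (Finset.sum_le_card_nsmul _ _ (‖x‖ * ‖fderiv ℝ h x‖) fun i _ => ?_).trans (by simp)
        rw [abs_mul]
        gcongr
        · exact abs_coord_le x i
        · simpa [pd] using (fderiv ℝ h x).le_opNorm (EuclideanSpace.single i 1)
      generalize hPd : ∑ i, x i * pd i h x = P at hP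
      have e2 : ∑ i, pd i (fun y => chi R y * (h y ^ 2 * (rho y ^ 4 * y i))) x =
          chi R x * (2 * h x * rho x ^ 4 * P
            + h x ^ 2 * (3 * rho x ^ 4 - 4 * rho x ^ 6 * ‖x‖ ^ 2))
          - (4 / R^2 * max 0 (1 - ‖x‖ ^ 2 / R ^ 2) * h x ^ 2 * rho x ^ 4) * ‖x‖ ^ 2 := by
        simp_rw [e]
        rw [← s2, ← hPd]
        simp only [Fin.sum_univ_three]; ring
      rw [e2]
      have hr := rho_sq_mul x
      have hp := rho_pos x
      have c0 := chi_nonneg R x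
      have c1 := chi_le_one R x
      have hn : 0 ≤ (4 / R^2 * max 0 (1 - ‖x‖ ^ 2 / R ^ 2) * h x ^ 2 * rho x ^ 4) * ‖x‖ ^ 2 := by
        have := le_max_left 0 (1 - ‖x‖ ^ 2 / R ^ 2)
        positivity
      have k1 : 3 * rho x ^ 4 - 4 * rho x ^ 6 * ‖x‖ ^ 2 = - rho x ^ 4 + 4 * rho x ^ 6 := by
        linear_combination (-4 * rho x ^ 4) * hr
      rw [k1]
      have k2 : 4 * rho x ^ 6 * h x ^ 2 * chi R x ≤ 1/2 * (chi R x * (rho x ^ 4 * h x ^ 2)) +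
          indicator (Metric.closedBall (0:E3) 3) (fun x => 4 * h x ^ 2) x := by
        by_cases hx : x ∈ Metric.closedBall (0:E3) 3
        · rw [indicator_of_mem hx]
          have : rho x ^ 6 ≤ 1 := pow_le_one₀ hp.le (rho_le_one x)
          have h6 : 0 ≤ rho x ^ 6 := by positivity
          have : rho x ^ 6 * chi R x ≤ 1 := mul_le_one₀ this c0 c1
          have : 0 ≤ 1/2 * (chi R x * (rho x ^ 4 * h x ^ 2)) := by positivity
          nlinarith [sq_nonneg (h x)]
        · rw [indicator_of_notMem hx]
          simp at hx
          have : rho x ^ 2 ≤ 1/8 := by nlinarith [sq_nonneg (rho x)]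
          have t : 0 ≤ chi R x * (rho x ^ 4 * h x ^ 2) := by positivity
          nlinarith [mul_le_mul_of_nonneg_left this t]
      have k3 : chi R x * (2 * h x * rho x ^ 4 * P) ≤ 1/4 * (chi R x * (rho x ^ 4 * h x ^ 2))
          + 36 * ‖fderiv ℝ h x‖^2 := by
        have q1 : P^2 ≤ 9 * (‖x‖^2 * ‖fderiv ℝ h x‖^2) := by
          have := sq_le_sq' (abs_le.mp hP).1 (abs_le.mp hP).2
          nlinarith
        have q2 : rho x ^ 4 * ‖x‖^2 ≤ 1 := by
          have : rho x ^ 2 ≤ 1 := pow_le_one₀ hp.le (rho_le_one x)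
          nlinarith [sq_nonneg (rho x)]
        have q3 : rho x ^ 4 * P^2 ≤ 9 * ‖fderiv ℝ h x‖^2 := by
          calc rho x ^ 4 * P^2 ≤ rho x ^ 4 * (9 * (‖x‖^2 * ‖fderiv ℝ h x‖^2)) := by gcongr
            _ = 9 * ((rho x ^ 4 * ‖x‖^2) * ‖fderiv ℝ h x‖^2) := by ring
            _ ≤ 9 * (1 * ‖fderiv ℝ h x‖^2) := by gcongr
            _ = _ := by ring
        have q4 : 2 * h x * P ≤ 1/4 * h x ^ 2 + 4 * P^2 := by nlinarith [sq_nonneg (h x / 2 - 2 * P)]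
        have q5 : 0 ≤ rho x ^ 4 * chi R x := by positivity
        have q6 : 4 * (chi R x * (rho x ^ 4 * P^2)) ≤ 36 * ‖fderiv ℝ h x‖^2 := by
          have : chi R x * (rho x ^ 4 * P^2) ≤ 1 * (rho x ^ 4 * P^2) := by gcongr
          linarith
        nlinarith [mul_le_mul_of_nonneg_left q4 q5]
      nlinarith
    have := integral_mono hi2 ((h_int1.const_mul (-(1/4))).add (hball.add (hfin.const_mul 36))) pw
    rw [hz2] at this
    have e3 : ∫ x, (-(1/4) * (chi R x * (rho x ^ 4 * h x ^ 2)) +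
          (indicator (Metric.closedBall (0:E3) 3) (fun x => 4 * h x ^ 2) x
            + 36 * ‖fderiv ℝ h x‖ ^ 2)) = -(1/4) * (∫ x, chi R x * (rho x ^ 4 * h x ^ 2)) +
          ((∫ x, indicator (Metric.closedBall (0:E3) 3) (fun x => 4 * h x ^ 2) x)
            + ∫ x, 36 * ‖fderiv ℝ h x‖ ^ 2) := by
      rw [← integral_const_mul, ← integral_add hball (hfin.const_mul 36)]
      exact integral_add (h_int1.const_mul (-(1/4))) (hball.add (hfin.const_mul 36))
    have e4 := this.trans_eq e3
    linarith
  set M := 4 * ((∫ x, indicator (Metric.closedBall (0:E3) 3) (fun x => 4 * h x ^ 2) x)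
        + ∫ x, 36 * ‖fderiv ℝ h x‖ ^ 2)
  refine (aecover_closedBall (x := (0:E3)) tendsto_natCast_atTop_atTop).integrable_of_integral_norm_bounded (2 * M)
    (fun n => hc4.continuousOn.integrableOn_compact (isCompact_closedBall _ _))
    (Eventually.of_forall fun n => ?_)
  set R : ℝ := 2 * ((n:ℝ) + 1)
  have hR : 1 ≤ R := by have : (0:ℝ) ≤ n := by positivity
                        simp only [R]; linarith
  have hR0 : 0 < R := by linarith
  have h_int1 : Integrable (fun x => chi R x * (rho x ^ 4 * h x ^ 2)) :=
    ((contDiff_chi R).continuous.mul hc4).integrable_of_hasCompactSupport ((chi_compact hR0).mul_right)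
  calc ∫ x in Metric.closedBall 0 (n:ℝ), ‖rho x ^ 4 * h x ^ 2‖
      ≤ ∫ x in Metric.closedBall 0 (n:ℝ), 2 * (chi R x * (rho x ^ 4 * h x ^ 2)) := by
        refine setIntegral_mono_on
          (hc4.norm.continuousOn.integrableOn_compact (isCompact_closedBall _ _))
          (h_int1.const_mul 2).integrableOn measurableSet_closedBall fun x hx => ?_
        have t : 0 ≤ rho x ^ 4 * h x ^ 2 := by positivity
        rw [Real.norm_of_nonneg t]
        simp at hx
        have c : 1/2 ≤ chi R x := by
          have : ‖x‖^2 / R^2 ≤ 1/4 := by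
            rw [div_le_iff₀ (by positivity)]
            have : ‖x‖ ≤ R/2 := by simp only [R]; linarith
            nlinarith [norm_nonneg x]
          have h2 : 3/4 ≤ max 0 (1 - ‖x‖ ^ 2 / R ^ 2) := le_max_of_le_right (by linarith)
          unfold chi; nlinarith
        nlinarith
    _ ≤ ∫ x, 2 * (chi R x * (rho x ^ 4 * h x ^ 2)) := by
        refine setIntegral_le_integral (h_int1.const_mul 2) (ae_of_all _ fun x => ?_)
        have := chi_nonneg R x
        show 0 ≤ 2 * (chi R x * (rho x ^ 4 * h x ^ 2))
        positivity
    _ ≤ 2 * M := by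
        rw [integral_const_mul]
        have := main R hR
        linarith

end part2

section part3

section gap
variable {H : Type*} [NormedAddCommGroup H] [InnerProductSpace ℝ H]
  {V : Type*} (e : ℕ → V → H) (nv : V → ℝ)

def genL (kv : ℕ × V) : H := (3 + 4 * (kv.1:ℝ) * (kv.1 + 2)) • e kv.1 kv.2
  - (4 * (kv.1:ℝ) * (kv.1 - 1) * nv kv.2) • e (kv.1 - 2) kv.2

def genE (kv : ℕ × V) : H := e kv.1 kv.2

def SN (V : Type*) (N : ℕ) : Set (ℕ × V) := {kv | kv.1 ≤ N}

def WN (N : ℕ) : Submodule ℝ H := Submodule.span ℝ (genE e '' SN V N)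

abbrev iE : (ℕ × V →₀ ℝ) →ₗ[ℝ] H := Finsupp.linearCombination ℝ (genE e)
abbrev iL : (ℕ × V →₀ ℝ) →ₗ[ℝ] H := Finsupp.linearCombination ℝ (genL e nv)

lemma WN_mono : Monotone (WN e) := fun N M h =>
  Submodule.span_mono (image_mono fun kv (hk : kv.1 ≤ N) => hk.trans h)

lemma mem_WN {k N : ℕ} (h : k ≤ N) (v : V) : e k v ∈ WN e N :=
  Submodule.subset_span ⟨(k, v), h, rfl⟩

lemma iE_mem {N : ℕ} {p : ℕ × V →₀ ℝ} (hp : p ∈ Finsupp.supported ℝ ℝ (SN V N)) :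
    iE e p ∈ WN e N :=
  (Finsupp.mem_span_image_iff_linearCombination ℝ).mpr ⟨p, hp, rfl⟩

lemma iL_mem {N : ℕ} {p : ℕ × V →₀ ℝ} (hp : p ∈ Finsupp.supported ℝ ℝ (SN V N)) :
    iL e nv p ∈ WN e N := by
  rw [iL, Finsupp.linearCombination_apply]
  refine Submodule.sum_mem _ fun kv hkv => Submodule.smul_mem _ _ ?_
  have hk : kv.1 ≤ N := hp hkv
  exact Submodule.sub_mem _ (Submodule.smul_mem _ _ (mem_WN e hk _))
    (Submodule.smul_mem _ _ (mem_WN e (by omega) _))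

lemma iL_sub_mem {N : ℕ} {p : ℕ × V →₀ ℝ} (hp : p ∈ Finsupp.supported ℝ ℝ (SN V (N + 1))) :
    iL e nv p - (3 + 4 * ((N+1 : ℕ):ℝ) * ((N+1 : ℕ) + 2)) • iE e p ∈ WN e N := by
  rw [iL, iE, Finsupp.linearCombination_apply, Finsupp.linearCombination_apply, Finsupp.sum,
    Finsupp.sum, Finset.smul_sum, ← Finset.sum_sub_distrib]
  refine Submodule.sum_mem _ fun kv hkv => ?_
  rw [smul_comm, ← smul_sub]
  refine Submodule.smul_mem _ _ ?_
  have hk : kv.1 ≤ N + 1 := hp hkv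
  rcases Nat.lt_or_ge kv.1 (N+1) with h | h
  · have h' : kv.1 ≤ N := by omega
    exact Submodule.sub_mem _ (Submodule.sub_mem _ (Submodule.smul_mem _ _ (mem_WN e h' _))
      (Submodule.smul_mem _ _ (mem_WN e (by omega) _))) (Submodule.smul_mem _ _ (mem_WN e h' _))
  · have h' : kv.1 = N + 1 := by omega
    unfold genL genE
    rw [h']
    have : ∀ (x y : H), x - y - x = - y := fun x y => by abel
    rw [this]
    exact Submodule.neg_mem _ (Submodule.smul_mem _ _ (mem_WN e (by omega) _))


lemma iL_sym (hsym : ∀ p q, inner ℝ (genL e nv p) (genE e q) = inner ℝ (genE e p) (genL e nv q))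
    (p q : ℕ × V →₀ ℝ) : inner ℝ (iL e nv p) (iE e q) = inner ℝ (iE e p) (iL e nv q) := by
  simp only [iL, iE, Finsupp.linearCombination_apply, Finsupp.sum, sum_inner, inner_sum,
    inner_smul_left, inner_smul_right, hsym]


lemma gap_fin (hsym : ∀ p q, inner ℝ (genL e nv p) (genE e q) = inner ℝ (genE e p) (genL e nv q))
    (hfd : ∀ N, FiniteDimensional ℝ (WN e N))
    (N : ℕ) : ∀ p ∈ Finsupp.supported ℝ ℝ (SN V (N+1)),
    (∀ w ∈ WN e 1, inner ℝ w (iE e p) = 0) →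
    35 * ‖iE e p‖ ^ 2 ≤ inner ℝ (iE e p) (iL e nv p) := by
  induction N with
  | zero =>
    intro p hp h
    have h0 : iE e p = 0 := by
      have := h _ (iE_mem e hp)
      exact inner_self_eq_zero.mp this
    rw [h0]; simp
  | succ N ih =>
    intro p hp h
    have := hfd (N+1)
    obtain ⟨q, hq, hqe⟩ := (Finsupp.mem_span_image_iff_linearCombination ℝ).mp
      ((WN e (N+1)).starProjection_apply_mem (iE e p))
    have horth : ∀ w ∈ WN e (N+1), inner ℝ w (iE e p - iE e q) = 0 := by
      intro w hw
      rw [iE, hqe]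
      exact (Submodule.mem_orthogonal _ _).mp (Submodule.sub_starProjection_mem_orthogonal _) w hw
    have hsub : SN V (N+1) ⊆ SN V (N+2) := fun kv hk => Nat.le_succ_of_le hk
    have hqs : q ∈ Finsupp.supported ℝ ℝ (SN V (N+2)) :=
      Finsupp.supported_mono hsub hq
    have hr : p - q ∈ Finsupp.supported ℝ ℝ (SN V (N+2)) := Submodule.sub_mem _ hp hqs
    have horth' : ∀ w ∈ WN e (N+1), inner ℝ w (iE e (p - q)) = 0 := by
      intro w hw; rw [map_sub]; exact horth w hw
    have ihq := ih q hq (fun w hw => by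
      have h1 := h w hw
      have h2 := horth w (WN_mono e (by omega) hw)
      rw [inner_sub_right] at h2
      linarith)
    set r := p - q
    have hpqr : p = q + r := by simp [r]
    have c1 : inner ℝ (iE e r) (iL e nv q) = 0 := by
      rw [real_inner_comm]; exact horth' _ (iL_mem e nv hq)
    have c2 : inner ℝ (iE e q) (iL e nv r) = 0 := by
      rw [← iL_sym e nv hsym]; exact horth' _ (iL_mem e nv hq)
    have c3 : inner ℝ (iE e q) (iE e r) = 0 := horth' _ (iE_mem e hq)
    have c4 : inner ℝ (iE e r) (iL e nv r) = (3 + 4 * ((N+1+1 : ℕ):ℝ) * ((N+1+1 : ℕ) + 2)) * ‖iE e r‖^2 := by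
      have := horth' _ (iL_sub_mem e nv hr)
      rw [inner_sub_left, inner_smul_left, real_inner_comm, real_inner_self_eq_norm_sq] at this
      simp only [conj_trivial] at this
      linarith
    have e1 : inner ℝ (iE e p) (iL e nv p) = inner ℝ (iE e q) (iL e nv q) + inner ℝ (iE e r) (iL e nv r) := by
      rw [hpqr, map_add, map_add, inner_add_left, inner_add_right, inner_add_right]; linarith
    have e2 : ‖iE e p‖^2 = ‖iE e q‖^2 + ‖iE e r‖^2 := by
      rw [hpqr, map_add, norm_add_sq_real, c3]; ring
    rw [e1, e2, c4]
    have hN : (0:ℝ) ≤ N := by positivity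
    push_cast
    nlinarith [mul_nonneg hN (sq_nonneg ‖iE e r‖), mul_nonneg (mul_nonneg hN hN) (sq_nonneg ‖iE e r‖)]

theorem abstract_gap (hsym : ∀ p q, inner ℝ (genL e nv p) (genE e q) = inner ℝ (genE e p) (genL e nv q))
    (hfd : ∀ N, FiniteDimensional ℝ (WN e N))
    [CompleteSpace H]
    (hdense : ∀ u : H, (∀ k v, inner ℝ u (e k v) = 0) → u = 0)
    (G : H) (hG : ∀ k ≤ 1, ∀ v, inner ℝ G (e k v) = 0) (a b : ℝ) (hab : a + b < 35)
    (hQ : ∀ p, inner ℝ G (iL e nv p) ≤ a / 2 * (‖G‖ ^ 2 + ‖iE e p‖ ^ 2) + b * inner ℝ G (iE e p)) :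
    G = 0 := by
  have hGW : ∀ w ∈ WN e 1, inner ℝ w G = 0 := by
    intro w hw
    induction hw using Submodule.span_induction with
    | mem x hx =>
      obtain ⟨kv, hk, rfl⟩ := hx
      rw [real_inner_comm]; exact hG _ hk _
    | zero => simp
    | add x y _ _ hx hy => rw [inner_add_left, hx, hy, add_zero]
    | smul c x _ hx => rw [inner_smul_left, hx, mul_zero]
  have htop : (⊤ : Submodule ℝ H) ≤ (⨆ N, WN e N).topologicalClosure := by
    rw [top_le_iff, Submodule.topologicalClosure_eq_top_iff, Submodule.eq_bot_iff]
    intro u hu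
    refine hdense u fun k v => ?_
    rw [real_inner_comm]
    exact (Submodule.mem_orthogonal _ _).mp hu _ (Submodule.mem_iSup_of_mem k (mem_WN e le_rfl v))
  have hten := Submodule.starProjection_tendsto_self (𝕜 := ℝ) (fun N => WN e N) (WN_mono e) G htop
  have hineq : ∀ N : ℕ, 35 * ‖(WN e (N+1)).starProjection G‖^2 ≤
      a / 2 * (‖G‖^2 + ‖(WN e (N+1)).starProjection G‖^2)
        + b * inner ℝ G ((WN e (N+1)).starProjection G) := by
    intro N
    obtain ⟨q, hq, hqe⟩ := (Finsupp.mem_span_image_iff_linearCombination ℝ).mp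
      ((WN e (N+1)).starProjection_apply_mem G)
    have horth : ∀ w ∈ WN e (N+1), inner ℝ w (G - iE e q) = 0 := by
      intro w hw
      rw [iE, hqe]
      exact (Submodule.mem_orthogonal _ _).mp (Submodule.sub_starProjection_mem_orthogonal _) w hw
    have hqg := gap_fin e nv hsym hfd N q hq (fun w hw => by
      have h1 := hGW w hw
      have h2 := horth w (WN_mono e (by omega) hw)
      rw [inner_sub_right] at h2
      linarith)
    have h3 := horth _ (iL_mem e nv hq)
    rw [inner_sub_right, real_inner_comm, real_inner_comm (iE e q)] at h3
    have := hQ q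
    rw [← hqe]
    simp only [iE] at *
    linarith
  have hten' := (tendsto_add_atTop_iff_nat 1).mpr hten
  have l1 : Tendsto (fun N : ℕ => 35 * ‖(WN e (N+1)).starProjection G‖^2) atTop (nhds (35 * ‖G‖^2)) :=
    (hten'.norm.pow 2).const_mul 35
  have l2 : Tendsto (fun N : ℕ => a / 2 * (‖G‖^2 + ‖(WN e (N+1)).starProjection G‖^2)
        + b * inner ℝ G ((WN e (N+1)).starProjection G)) atTop
      (nhds (a / 2 * (‖G‖^2 + ‖G‖^2) + b * inner ℝ G G)) :=
    (((hten'.norm.pow 2).const_add _).const_mul _).add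
      ((tendsto_const_nhds.inner hten').const_mul b)
  have := le_of_tendsto_of_tendsto' l1 l2 hineq
  rw [real_inner_self_eq_norm_sq] at this
  have h0 : ‖G‖^2 = 0 := by nlinarith [sq_nonneg ‖G‖]
  simpa using h0
end gap

end part3

section part4

lemma rho_rpow (s : ℝ) (x : E3) : rho x ^ s = (1 + ‖x‖ ^ 2) ^ (-s / 2) := by
  have h := one_add_pos x
  rw [rho, Real.sqrt_eq_rpow, ← Real.rpow_neg h.le, ← Real.rpow_mul h.le]
  congr 1; ring

lemma rho_two_le {y z : E3} (h : ‖z - y‖ * rho y ≤ 1 / 2) : rho z ≤ 2 * rho y := by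
  have hy := rho_pos y
  have hz := rho_pos z
  have h1 := rho_sq_mul y
  have h2 := rho_sq_mul z
  have h3 : ‖y‖ ≤ ‖z‖ + ‖z - y‖ := by
    have := norm_sub_le z (z - y); simpa using this
  have h4 : (‖z - y‖ * rho y) ^ 2 ≤ 1 / 4 := by
    have : 0 ≤ ‖z - y‖ * rho y := by positivity
    nlinarith
  have h5 : ‖y‖ ^ 2 ≤ 2 * ‖z‖ ^ 2 + 2 * ‖z - y‖ ^ 2 := by
    nlinarith [norm_nonneg y, norm_nonneg z, norm_nonneg (z - y), sq_nonneg (‖z‖ - ‖z - y‖)]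
  have h6 : ‖z - y‖ ^ 2 ≤ 1 / 4 * (1 + ‖y‖ ^ 2) := by
    have e : ‖z - y‖ ^ 2 = (‖z - y‖ * rho y) ^ 2 * (1 + ‖y‖ ^ 2) := by
      rw [mul_pow, mul_assoc, h1, mul_one]
    rw [e]; gcongr
  have h7 : 1 + ‖y‖ ^ 2 ≤ 4 * (1 + ‖z‖ ^ 2) := by nlinarith [sq_nonneg ‖z‖]
  have h8 : rho z ^ 2 ≤ (2 * rho y) ^ 2 := by
    have : rho z ^ 2 = rho z ^ 2 * rho y ^ 2 * (1 + ‖y‖ ^ 2) := by rw [mul_assoc, h1, mul_one]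
    rw [this]
    calc rho z ^ 2 * rho y ^ 2 * (1 + ‖y‖ ^ 2) ≤ rho z ^ 2 * rho y ^ 2 * (4 * (1 + ‖z‖ ^ 2)) := by gcongr
      _ = 4 * rho y ^ 2 * (rho z ^ 2 * (1 + ‖z‖ ^ 2)) := by ring
      _ = (2 * rho y) ^ 2 := by rw [h2]; ring
  exact le_of_sq_le_sq h8 (by positivity)

lemma rho_smul_add_le (a : ℝ) (b y : E3) : ‖a • y + b‖ * rho y ≤ |a| + ‖b‖ := by
  have hy := rho_pos y
  calc ‖a • y + b‖ * rho y ≤ (|a| * ‖y‖ + ‖b‖) * rho y := by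
        gcongr; exact (norm_add_le _ _).trans (by rw [norm_smul, Real.norm_eq_abs])
    _ = |a| * (rho y * ‖y‖) + ‖b‖ * rho y := by ring
    _ ≤ |a| * 1 + ‖b‖ * 1 := by gcongr; exacts [rho_norm_le y, rho_le_one y]
    _ = _ := by ring

lemma hasDerivAt_rho_line (s : ℝ) (y w : E3) (t : ℝ) :
    HasDerivAt (fun t : ℝ => rho (y + t • w) ^ s)
      (-s * rho (y + t • w) ^ (s + 2) * inner ℝ (y + t • w) w) t := by
  have h1 : HasDerivAt (fun t : ℝ => y + t • w) w t := by
    simpa using ((hasDerivAt_id t).smul_const w).const_add y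
  have h2 : HasDerivAt (fun t : ℝ => 1 + ‖y + t • w‖ ^ 2) (2 * inner ℝ (y + t • w) w) t :=
    h1.norm_sq.const_add 1
  have h3 := h2.rpow_const (p := -s / 2) (Or.inl (one_add_pos _).ne')
  simp only [rho_rpow]
  convert h3 using 1
  rw [show -(s + 2) / 2 = -s / 2 - 1 by ring]
  ring

section kernel
variable (α B : ℝ)

variable {α B} in
lemma hB_integrable (hBpos : 0 < B)
    (hB : ∀ x : E3, B * ∫ y : E3, rho y ^ (6 - α) / ‖x - y‖ ^ α = rho x ^ α) (x : E3) :
    Integrable (fun y : E3 => rho y ^ (6 - α) / ‖x - y‖ ^ α) := by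
  by_contra hc
  have := hB x
  rw [integral_undef hc, mul_zero] at this
  exact (Real.rpow_pos_of_pos (rho_pos x) α).ne this

variable {α B} in
lemma F_change (hBpos : 0 < B)
    (hB : ∀ x : E3, B * ∫ y : E3, rho y ^ (6 - α) / ‖x - y‖ ^ α = rho x ^ α)
    (x b : E3) {c : ℝ} (hc : 0 < c) :
    B * ∫ y : E3, rho (c • y + b) ^ (6 - α) / ‖x - y‖ ^ α = c ^ (α - 3) * rho (c • x + b) ^ α := by
  rw [← hB (c • x + b)]
  have h1 : ∀ y : E3, rho (c • y + b) ^ (6 - α) / ‖x - y‖ ^ α =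
      c ^ α * (fun u : E3 => (fun z : E3 => rho z ^ (6 - α) / ‖c • x + b - z‖ ^ α) (u + b)) (c • y) := by
    intro y
    have : c • x + b - (c • y + b) = c • (x - y) := by rw [smul_sub]; abel
    simp only [this, norm_smul, Real.norm_eq_abs, abs_of_pos hc]
    rw [Real.mul_rpow hc.le (norm_nonneg _)]
    have := (Real.rpow_pos_of_pos hc α).ne'
    rw [← mul_div_assoc, mul_div_mul_left _ _ this]
  simp_rw [h1]
  rw [integral_const_mul, Measure.integral_comp_smul volume (fun u : E3 => (fun z : E3 => rho z ^ (6 - α) / ‖c • x + b - z‖ ^ α) (u + b)) c, integral_add_right_eq_self (fun z : E3 => rho z ^ (6 - α) / ‖c • x + b - z‖ ^ α)]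
  have : Real.rpow c (α - 3) = c ^ α * (c ^ 3)⁻¹ := by
    show c ^ (α - 3) = _
    rw [Real.rpow_sub hc, div_eq_mul_inv]; norm_cast
  change _ = Real.rpow c (α - 3) * _
  rw [this]
  simp [abs_of_pos hc]
  ring

variable {α B} in
theorem T_sg (hα : α ∈ Ioo (0:ℝ) 3) (hBpos : 0 < B)
    (hB : ∀ x : E3, B * ∫ y : E3, rho y ^ (6 - α) / ‖x - y‖ ^ α = rho x ^ α)
    (a : ℝ) (b x : E3) :
    Integrable (fun y : E3 => rho y ^ (6 - α) * sg a b y / ‖x - y‖ ^ α) ∧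
    B * ∫ y : E3, rho y ^ (6 - α) * sg a b y / ‖x - y‖ ^ α = α / (6 - α) * rho x ^ α * sg a b x := by
  obtain ⟨h0, h3⟩ := hα
  have hI := hB_integrable hBpos hB x
  set M := |a| + ‖b‖ with hM
  have hM0 : 0 ≤ M := by positivity
  set δ : ℝ := 1 / (2 * (M + 1)) with hδ
  have hδ0 : 0 < δ := by positivity
  have hδM : δ * M ≤ 1 / 2 := by
    rw [hδ, div_mul_eq_mul_div, div_le_iff₀ (by positivity)]; nlinarith
  have hmeas : ∀ t : ℝ, AEStronglyMeasurable
      (fun y : E3 => rho (y + t • (a • y + b)) ^ (6 - α) / ‖x - y‖ ^ α) volume := by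
    intro t
    refine Measurable.aestronglyMeasurable ?_
    have : Measurable rho := continuous_rho.measurable
    fun_prop
  have hderiv : ∀ (y : E3) (t : ℝ), HasDerivAt
      (fun t : ℝ => rho (y + t • (a • y + b)) ^ (6 - α) / ‖x - y‖ ^ α)
      (-(6 - α) * rho (y + t • (a • y + b)) ^ (6 - α + 2)
        * inner ℝ (y + t • (a • y + b)) (a • y + b) / ‖x - y‖ ^ α) t := fun y t =>
    (hasDerivAt_rho_line (6 - α) y (a • y + b) t).div_const _
  have hbound : ∀ (y : E3), ∀ t ∈ Metric.ball (0:ℝ) δ,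
      ‖-(6 - α) * rho (y + t • (a • y + b)) ^ (6 - α + 2)
        * inner ℝ (y + t • (a • y + b)) (a • y + b) / ‖x - y‖ ^ α‖ ≤
      (6 - α) * 2 ^ (7 - α) * M * (rho y ^ (6 - α) / ‖x - y‖ ^ α) := by
    intro y t ht
    have ht' : |t| ≤ δ := by simpa using (mem_ball_zero_iff.mp ht).le
    set w := a • y + b
    set z := y + t • w with hz
    have hw : ‖w‖ * rho y ≤ M := rho_smul_add_le a b y
    have hy := rho_pos y
    have hzp := rho_pos z
    have h2 : rho z ≤ 2 * rho y := by
      apply rho_two_le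
      have : z - y = t • w := by simp [hz]
      rw [this, norm_smul, Real.norm_eq_abs, mul_assoc]
      calc |t| * (‖w‖ * rho y) ≤ δ * M := by gcongr
        _ ≤ _ := hδM
    rw [norm_div, norm_mul, norm_mul, Real.norm_eq_abs, Real.norm_eq_abs, Real.norm_eq_abs,
      Real.norm_eq_abs, abs_neg, abs_of_pos (by linarith : 0 < 6 - α),
      abs_of_pos (Real.rpow_pos_of_pos hzp _), abs_of_nonneg (Real.rpow_nonneg (norm_nonneg _) _),
      ← mul_div_assoc]
    refine div_le_div_of_nonneg_right ?_ (Real.rpow_nonneg (norm_nonneg _) _)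
    calc (6 - α) * rho z ^ (6 - α + 2) * |inner ℝ z w|
        ≤ (6 - α) * rho z ^ (6 - α + 2) * (‖z‖ * ‖w‖) := by
          have : 0 ≤ 6 - α := by linarith
          gcongr; exact abs_real_inner_le_norm z w
      _ = (6 - α) * rho z ^ (7 - α) * ((rho z * ‖z‖) * ‖w‖) := by
          rw [show 6 - α + 2 = (7 - α) + 1 by ring, Real.rpow_add hzp, Real.rpow_one]; ring
      _ ≤ (6 - α) * (2 * rho y) ^ (7 - α) * (1 * ‖w‖) := by
          have : 0 ≤ 6 - α := by linarith
          gcongr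
          · linarith
          · exact rho_norm_le z
      _ = (6 - α) * 2 ^ (7 - α) * (‖w‖ * rho y) * rho y ^ (6 - α) := by
          rw [Real.mul_rpow (by norm_num) hy.le, show 7 - α = (6 - α) + 1 by ring,
            Real.rpow_add hy, Real.rpow_one]; ring
      _ ≤ (6 - α) * 2 ^ (7 - α) * M * rho y ^ (6 - α) := by
          have : 0 ≤ 6 - α := by linarith
          gcongr
  have key := hasDerivAt_integral_of_dominated_loc_of_deriv_le (μ := volume) (𝕜 := ℝ) (x₀ := (0:ℝ))
    (s := Metric.ball 0 δ)
    (F := fun t (y : E3) => rho (y + t • (a • y + b)) ^ (6 - α) / ‖x - y‖ ^ α)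
    (F' := fun t (y : E3) => -(6 - α) * rho (y + t • (a • y + b)) ^ (6 - α + 2)
        * inner ℝ (y + t • (a • y + b)) (a • y + b) / ‖x - y‖ ^ α)
    (bound := fun y => (6 - α) * 2 ^ (7 - α) * M * (rho y ^ (6 - α) / ‖x - y‖ ^ α))
    (Metric.ball_mem_nhds _ hδ0) (Eventually.of_forall hmeas) (by simpa using hI)
    (by
      refine Measurable.aestronglyMeasurable ?_
      have : Measurable rho := continuous_rho.measurable
      fun_prop)
    (ae_of_all _ hbound) (hI.const_mul _) (ae_of_all _ fun y t _ => hderiv y t)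
  obtain ⟨kI, kD⟩ := key
  have hpt : ∀ y : E3, -(6 - α) * rho (y + (0:ℝ) • (a • y + b)) ^ (6 - α + 2)
        * inner ℝ (y + (0:ℝ) • (a • y + b)) (a • y + b) / ‖x - y‖ ^ α
      = -(6 - α) / 2 * (rho y ^ (6 - α) * sg a b y / ‖x - y‖ ^ α)
        + -(6 - α) / 2 * a * (rho y ^ (6 - α) / ‖x - y‖ ^ α) := by
    intro y
    have hs : sg a b y = 2 * (rho y ^ 2 * inner ℝ y (a • y + b)) - a := by
      have := rho_sq_mul y
      rw [sg, inner_add_right, inner_smul_right, real_inner_self_eq_norm_sq, real_inner_comm]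
      linear_combination (-2 * a) * this
    rw [zero_smul, add_zero, hs, Real.rpow_add (rho_pos y)]
    norm_cast
    ring
  simp_rw [hpt] at kI kD
  have hc : -(6 - α) / 2 ≠ 0 := by
    have : -(6 - α) / 2 < 0 := by linarith
    exact this.ne
  have i1 : Integrable (fun y : E3 => rho y ^ (6 - α) * sg a b y / ‖x - y‖ ^ α) := by
    have := (kI.sub (hI.const_mul (-(6 - α) / 2 * a)))
    have h := this.const_mul (-(6 - α) / 2)⁻¹
    refine h.congr (ae_of_all _ fun y => ?_)
    simp only [Pi.sub_apply, add_sub_cancel_right]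
    exact inv_mul_cancel_left₀ hc _
  refine ⟨i1, ?_⟩
  rw [integral_add (i1.const_mul _) (hI.const_mul _), integral_const_mul, integral_const_mul] at kD
  have kD2 := kD.const_mul B
  have hR : HasDerivAt (fun t : ℝ => (1 + t * a) ^ (α - 3) * rho (x + t • (a • x + b)) ^ α)
      ((α - 3) * a * rho x ^ α + (-α * rho x ^ (α + 2) * inner ℝ x (a • x + b))) 0 := by
    have d1 : HasDerivAt (fun t : ℝ => 1 + t * a) a 0 := by
      simpa using ((hasDerivAt_id (0:ℝ)).mul_const a).const_add 1
    have d2 := d1.rpow_const (p := α - 3) (Or.inl (by simp))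
    have d3 := d2.mul (hasDerivAt_rho_line α x (a • x + b) 0)
    refine d3.congr_deriv ?_
    simp only [zero_mul, zero_smul, add_zero, Real.one_rpow]
    ring
  have heq : (fun t : ℝ => B * ∫ y : E3, rho (y + t • (a • y + b)) ^ (6 - α) / ‖x - y‖ ^ α)
      =ᶠ[nhds 0] (fun t : ℝ => (1 + t * a) ^ (α - 3) * rho (x + t • (a • x + b)) ^ α) := by
    filter_upwards [Metric.ball_mem_nhds (0:ℝ) hδ0] with t ht
    have ht' : |t| ≤ δ := by simpa using (mem_ball_zero_iff.mp ht).le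
    have hta : |t * a| ≤ 1 / 2 := by
      rw [abs_mul]
      calc |t| * |a| ≤ δ * M := by gcongr; simp [hM]
        _ ≤ _ := hδM
    have hc : 0 < 1 + t * a := by have := (abs_le.mp hta).1; linarith
    have e : ∀ y : E3, y + t • (a • y + b) = (1 + t * a) • y + t • b := by
      intro y; rw [add_smul, one_smul, smul_add, smul_smul]; abel
    simp_rw [e]
    exact F_change hBpos hB x (t • b) hc
  have := (kD2.congr_of_eventuallyEq heq.symm).unique hR
  have hs : sg a b x = 2 * (rho x ^ 2 * inner ℝ x (a • x + b)) - a := by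
    have := rho_sq_mul x
    rw [sg, inner_add_right, inner_smul_right, real_inner_self_eq_norm_sq, real_inner_comm]
    linear_combination (-2 * a) * this
  have hBx := hB x
  rw [Real.rpow_add (rho_pos x)] at this
  norm_cast at this
  have h6 : 6 - α ≠ 0 := by linarith
  rw [hs]
  have e2 : (6 - α) * (B * ∫ y : E3, rho y ^ (6 - α) * sg a b y / ‖x - y‖ ^ α) = α * rho x ^ α * (2 * (rho x ^ 2 * inner ℝ x (a • x + b)) - a) := by
    linear_combination -2 * this - (6 - α) * a * hBx
  field_simp
  linear_combination e2

end kernel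

end part4

section part5

section schur
variable {K : E3 → E3 → ℝ} {w : E3 → ℝ}

lemma schur_aux (hKm : Measurable (Function.uncurry K)) (hK0 : ∀ x y, 0 ≤ K x y)
    (hwm : Measurable w) (hw : ∀ x, 0 < w x)
    (hI : ∀ x, Integrable (fun y => K x y * w y)) (hKw : ∀ x, ∫ y, K x y * w y = w x)
    {v : E3 → ℝ} (hv : Measurable v) (hv2 : Integrable (fun x => v x ^ 2)) :
    Integrable (fun z : E3 × E3 => K z.1 z.2 * w z.2 * (v z.1 ^ 2 / w z.1)) (volume.prod volume) ∧
    ∫ z : E3 × E3, K z.1 z.2 * w z.2 * (v z.1 ^ 2 / w z.1) ∂(volume.prod volume) = ∫ x, v x ^ 2 := by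
  have hin : ∀ x, ∫ y, K x y * w y * (v x ^ 2 / w x) = v x ^ 2 := by
    intro x
    rw [integral_mul_const, hKw, mul_div_cancel₀ _ (hw x).ne']
  have hm : Measurable (fun z : E3 × E3 => K z.1 z.2 * w z.2 * (v z.1 ^ 2 / w z.1)) := by
    have : Measurable (fun z : E3 × E3 => K z.1 z.2) := hKm
    fun_prop
  have i : Integrable (fun z : E3 × E3 => K z.1 z.2 * w z.2 * (v z.1 ^ 2 / w z.1)) (volume.prod volume) := by
    rw [integrable_prod_iff hm.aestronglyMeasurable]
    refine ⟨ae_of_all _ fun x => (hI x).mul_const (v x ^ 2 / w x), ?_⟩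
    refine hv2.congr (ae_of_all _ fun x => ?_)
    show v x ^ 2 = _
    rw [← hin x]
    refine integral_congr_ae (ae_of_all _ fun y => ?_)
    show K x y * w y * (v x ^ 2 / w x) = ‖K x y * w y * (v x ^ 2 / w x)‖
    rw [Real.norm_eq_abs, abs_of_nonneg]
    have := hw x; have := hw y; have := hK0 x y
    positivity
  refine ⟨i, ?_⟩
  rw [integral_prod _ i]
  simp only [hin]

theorem schur (hKm : Measurable (Function.uncurry K)) (hK0 : ∀ x y, 0 ≤ K x y)
    (hsymm : ∀ x y, K x y = K y x)
    (hwm : Measurable w) (hw : ∀ x, 0 < w x)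
    (hI : ∀ x, Integrable (fun y => K x y * w y)) (hKw : ∀ x, ∫ y, K x y * w y = w x)
    {u v : E3 → ℝ} (hu : Measurable u) (hu2 : Integrable (fun x => u x ^ 2))
    (hv : Measurable v) (hv2 : Integrable (fun x => v x ^ 2)) :
    Integrable (fun z : E3 × E3 => K z.1 z.2 * u z.2 * v z.1) (volume.prod volume) ∧
    ∫ z : E3 × E3, K z.1 z.2 * u z.2 * v z.1 ∂(volume.prod volume)
      ≤ 1 / 2 * ((∫ x, u x ^ 2) + ∫ x, v x ^ 2) := by
  obtain ⟨i1, e1⟩ := schur_aux hKm hK0 hwm hw hI hKw hv hv2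
  obtain ⟨i2, e2⟩ := schur_aux hKm hK0 hwm hw hI hKw hu hu2
  have i2' := i2.swap
  have e2' := integral_prod_swap (μ := volume) (ν := volume) (fun z : E3 × E3 => K z.1 z.2 * w z.2 * (u z.1 ^ 2 / w z.1))
  rw [e2] at e2'
  have hm : Measurable (fun z : E3 × E3 => K z.1 z.2 * u z.2 * v z.1) := by
    have : Measurable (fun z : E3 × E3 => K z.1 z.2) := hKm
    fun_prop
  have hle : ∀ z : E3 × E3, |K z.1 z.2 * u z.2 * v z.1| ≤
      1 / 2 * (K z.2 z.1 * w z.1 * (u z.2 ^ 2 / w z.2) + K z.1 z.2 * w z.2 * (v z.1 ^ 2 / w z.1)) := by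
    rintro ⟨x, y⟩
    simp only
    have hx := hw x; have hy := hw y; have hk := hK0 x y
    rw [hsymm y x, mul_assoc, abs_mul, abs_of_nonneg hk, abs_mul]
    have : |u y| * |v x| ≤ 1 / 2 * (w x * (u y ^ 2 / w y) + w y * (v x ^ 2 / w x)) := by
      rw [← sq_abs (u y), ← sq_abs (v x)]
      have h := sq_nonneg (w x * |u y| - w y * |v x|)
      have e : w x * (|u y| ^ 2 / w y) + w y * (|v x| ^ 2 / w x) =
        ((w x * |u y|) ^ 2 + (w y * |v x|) ^ 2) / (w x * w y) := by field_simp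
      rw [e, ← mul_div_assoc, le_div_iff₀ (by positivity)]
      nlinarith
    calc K x y * (|u y| * |v x|) ≤ K x y * (1 / 2 * (w x * (u y ^ 2 / w y) + w y * (v x ^ 2 / w x))) := by
          gcongr
      _ = _ := by ring
  have i3 := (i2'.add i1).const_mul (1 / 2)
  have i : Integrable (fun z : E3 × E3 => K z.1 z.2 * u z.2 * v z.1) (volume.prod volume) :=
    i3.mono' hm.aestronglyMeasurable (ae_of_all _ hle)
  refine ⟨i, ?_⟩
  calc _ ≤ ∫ z : E3 × E3, 1 / 2 * (K z.2 z.1 * w z.1 * (u z.2 ^ 2 / w z.2) + K z.1 z.2 * w z.2 * (v z.1 ^ 2 / w z.1)) ∂(volume.prod volume) :=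
        integral_mono i i3 fun z => (le_abs_self _).trans (hle z)
    _ = _ := by
      rw [integral_const_mul, ← e1]
      congr 1
      rw [← e2']
      exact integral_add i2' i1
end schur

def KK (α B : ℝ) (x y : E3) : ℝ := B * rho x ^ (3 - α) * rho y ^ (3 - α) / ‖x - y‖ ^ α

lemma KK_meas (α B : ℝ) : Measurable (Function.uncurry (KK α B)) := by
  have : Measurable rho := continuous_rho.measurable
  unfold KK Function.uncurry
  fun_prop

lemma KK_nonneg (α : ℝ) {B : ℝ} (hB : 0 < B) (x y : E3) : 0 ≤ KK α B x y := by
  have := rho_pos x; have := rho_pos y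
  unfold KK; positivity

lemma KK_symm (α B : ℝ) (x y : E3) : KK α B x y = KK α B y x := by
  unfold KK; rw [norm_sub_rev]; ring

lemma rpow_shift (x : E3) (s : ℝ) (n : ℕ) : rho x ^ s * rho x ^ n = rho x ^ (s + n) := by
  rw [Real.rpow_add (rho_pos x), Real.rpow_natCast]

lemma KK_rho3 (α B : ℝ) (x y : E3) (t : ℝ) : KK α B x y * (rho y ^ 3 * t)
    = B * rho x ^ (3 - α) * (rho y ^ (6 - α) * t / ‖x - y‖ ^ α) := by
  unfold KK
  rw [show 6 - α = (3 - α) + (3:ℕ) by push_cast; ring, ← rpow_shift]; ring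

lemma KK_rho2 (α B : ℝ) (x y : E3) (t : ℝ) : KK α B x y * (rho y ^ 2 * t)
    = B * rho x ^ (3 - α) * (rho y ^ (5 - α) * t / ‖x - y‖ ^ α) := by
  unfold KK
  rw [show 5 - α = (3 - α) + (2:ℕ) by push_cast; ring, ← rpow_shift]; ring

/-- the bilinear form -/
def QQ (α B : ℝ) (u v : E3 → ℝ) : ℝ :=
  ∫ z : E3 × E3, KK α B z.1 z.2 * u z.2 * v z.1 ∂(volume.prod volume)

section form
variable {α B : ℝ}

lemma KK_w (hBpos : 0 < B)
    (hB : ∀ x : E3, B * ∫ y : E3, rho y ^ (6 - α) / ‖x - y‖ ^ α = rho x ^ α)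
    (x : E3) : Integrable (fun y => KK α B x y * rho y ^ 3) ∧
    ∫ y, KK α B x y * rho y ^ 3 = rho x ^ 3 := by
  have h := fun y => KK_rho3 α B x y 1
  simp only [mul_one] at h
  simp_rw [h]
  refine ⟨(hB_integrable hBpos hB x).const_mul _, ?_⟩
  rw [integral_const_mul]
  calc _ = rho x ^ (3 - α) * (B * ∫ y : E3, rho y ^ (6 - α) / ‖x - y‖ ^ α) := by ring
    _ = rho x ^ 3 := by
      rw [hB, ← Real.rpow_add (rho_pos x)]
      norm_num

lemma QQ_int (hBpos : 0 < B)
    (hB : ∀ x : E3, B * ∫ y : E3, rho y ^ (6 - α) / ‖x - y‖ ^ α = rho x ^ α)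
    {u v : E3 → ℝ} (hu : Continuous u) (hu2 : Integrable (fun x => u x ^ 2))
    (hv : Continuous v) (hv2 : Integrable (fun x => v x ^ 2)) :
    Integrable (fun z : E3 × E3 => KK α B z.1 z.2 * u z.2 * v z.1) (volume.prod volume) ∧
    QQ α B u v ≤ 1 / 2 * ((∫ x, u x ^ 2) + ∫ x, v x ^ 2) :=
  schur (w := fun x => rho x ^ 3) (KK_meas α B) (KK_nonneg α hBpos) (KK_symm α B) (continuous_rho.pow 3).measurable
    (fun x => pow_pos (rho_pos x) 3) (fun x => (KK_w hBpos hB x).1) (fun x => (KK_w hBpos hB x).2)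
    hu.measurable hu2 hv.measurable hv2

lemma QQ_fubini (hBpos : 0 < B)
    (hB : ∀ x : E3, B * ∫ y : E3, rho y ^ (6 - α) / ‖x - y‖ ^ α = rho x ^ α)
    {u v : E3 → ℝ} (hu : Continuous u) (hu2 : Integrable (fun x => u x ^ 2))
    (hv : Continuous v) (hv2 : Integrable (fun x => v x ^ 2)) :
    Integrable (fun x => v x * ∫ y, KK α B x y * u y) ∧
    QQ α B u v = ∫ x, v x * ∫ y, KK α B x y * u y := by
  have h := (QQ_int hBpos hB hu hu2 hv hv2).1
  have e : ∀ x, ∫ y, KK α B x y * u y * v x = v x * ∫ y, KK α B x y * u y := fun x => by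
    rw [integral_mul_const, mul_comm]
  constructor
  · refine h.integral_prod_left.congr (ae_of_all _ fun x => e x)
  · rw [QQ, integral_prod _ h]
    exact integral_congr_ae (ae_of_all _ fun x => e x)

lemma QQ_symm (hBpos : 0 < B)
    (hB : ∀ x : E3, B * ∫ y : E3, rho y ^ (6 - α) / ‖x - y‖ ^ α = rho x ^ α)
    {u v : E3 → ℝ} : QQ α B u v = QQ α B v u := by
  unfold QQ
  rw [← integral_prod_swap]
  refine integral_congr_ae (ae_of_all _ fun z => ?_)
  simp only [Prod.fst_swap, Prod.snd_swap]
  rw [KK_symm]; ring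

lemma QQ_add_right (hBpos : 0 < B)
    (hB : ∀ x : E3, B * ∫ y : E3, rho y ^ (6 - α) / ‖x - y‖ ^ α = rho x ^ α)
    {u v v' : E3 → ℝ} (hu : Continuous u) (hu2 : Integrable (fun x => u x ^ 2))
    (hv : Continuous v) (hv2 : Integrable (fun x => v x ^ 2))
    (hv' : Continuous v') (hv2' : Integrable (fun x => v' x ^ 2)) (c : ℝ) :
    QQ α B u (fun x => v x + c * v' x) = QQ α B u v + c * QQ α B u v' := by
  unfold QQ
  rw [← integral_const_mul, ← integral_add (QQ_int hBpos hB hu hu2 hv hv2).1 ((QQ_int hBpos hB hu hu2 hv' hv2').1.const_mul c)]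
  congr 1; funext z; ring

lemma QQ_one (hBpos : 0 < B)
    (hB : ∀ x : E3, B * ∫ y : E3, rho y ^ (6 - α) / ‖x - y‖ ^ α = rho x ^ α)
    {u : E3 → ℝ} (hu : Continuous u) (hu2 : Integrable (fun x => u x ^ 2))
    (h3 : Integrable (fun x : E3 => (rho x ^ 3) ^ 2)) :
    QQ α B u (fun x => rho x ^ 3) = ∫ x, u x * rho x ^ 3 := by
  rw [QQ_symm hBpos hB, (QQ_fubini hBpos hB (u := fun x => rho x ^ 3) (continuous_rho.pow 3) h3 hu hu2).2]
  simp_rw [(KK_w hBpos hB _).2]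

lemma QQ_sg (hα : α ∈ Ioo (0:ℝ) 3)
    (hBpos : 0 < B)
    (hB : ∀ x : E3, B * ∫ y : E3, rho y ^ (6 - α) / ‖x - y‖ ^ α = rho x ^ α)
    {u : E3 → ℝ} (hu : Continuous u) (hu2 : Integrable (fun x => u x ^ 2)) (a : ℝ) (b : E3)
    (h3 : Integrable (fun x : E3 => (rho x ^ 3 * sg a b x) ^ 2)) :
    QQ α B u (fun x => rho x ^ 3 * sg a b x) = α / (6 - α) * ∫ x, u x * (rho x ^ 3 * sg a b x) := by
  rw [QQ_symm hBpos hB, (QQ_fubini hBpos hB (u := fun x => rho x ^ 3 * sg a b x) ((continuous_rho.pow 3).mul (contDiff_sg a b (n := 0)).continuous) h3 hu hu2).2,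
    ← integral_const_mul]
  congr 1; funext x
  simp_rw [KK_rho3]
  rw [integral_const_mul]
  have h := (T_sg hα hBpos hB a b x).2
  calc u x * (B * rho x ^ (3 - α) * ∫ y : E3, rho y ^ (6 - α) * sg a b y / ‖x - y‖ ^ α)
      = u x * rho x ^ (3 - α) * (B * ∫ y : E3, rho y ^ (6 - α) * sg a b y / ‖x - y‖ ^ α) := by ring
    _ = α / (6 - α) * (u x * ((rho x ^ (3 - α) * rho x ^ α) * sg a b x)) := by rw [h]; ring
    _ = _ := by
      rw [← Real.rpow_add (rho_pos x)]
      norm_num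
end form

end part5

section part6

/-- continuous functions of order `rho ^ n` -/
def BB (n : ℕ) (f : E3 → ℝ) : Prop := Continuous f ∧ ∃ C, ∀ x, |f x| ≤ C * rho x ^ n

lemma BB.mul {n m : ℕ} {f g : E3 → ℝ} (hf : BB n f) (hg : BB m g) :
    BB (n + m) (fun x => f x * g x) := by
  obtain ⟨cf, C, hC⟩ := hf
  obtain ⟨cg, D, hD⟩ := hg
  refine ⟨cf.mul cg, C * D, fun x => ?_⟩
  rw [abs_mul]
  calc |f x| * |g x| ≤ (C * rho x ^ n) * (D * rho x ^ m) :=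
        mul_le_mul (hC x) (hD x) (abs_nonneg _) ((abs_nonneg _).trans (hC x))
    _ = _ := by ring

lemma BB.add {n : ℕ} {f g : E3 → ℝ} (hf : BB n f) (hg : BB n g) :
    BB n (fun x => f x + g x) := by
  obtain ⟨cf, C, hC⟩ := hf
  obtain ⟨cg, D, hD⟩ := hg
  refine ⟨cf.add cg, C + D, fun x => (abs_add_le _ _).trans ?_⟩
  have := hC x; have := hD x
  linarith

lemma BB.const_mul {n : ℕ} {f : E3 → ℝ} (c : ℝ) (hf : BB n f) : BB n (fun x => c * f x) := by
  obtain ⟨cf, C, hC⟩ := hf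
  refine ⟨cf.const_mul c, |c| * C, fun x => ?_⟩
  rw [abs_mul, mul_assoc]
  exact mul_le_mul_of_nonneg_left (hC x) (abs_nonneg c)

lemma BB.sub {n : ℕ} {f g : E3 → ℝ} (hf : BB n f) (hg : BB n g) :
    BB n (fun x => f x - g x) := by
  have := hf.add (hg.const_mul (-1))
  simpa [sub_eq_add_neg] using this

lemma BB.const (c : ℝ) : BB 0 (fun _ => c) := ⟨continuous_const, |c|, fun x => by simp⟩

lemma BB.mono {n m : ℕ} (h : n ≤ m) {f : E3 → ℝ} (hf : BB m f) : BB n f := by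
  obtain ⟨cf, C, hC⟩ := hf
  refine ⟨cf, |C|, fun x => (hC x).trans ?_⟩
  have := rho_pos x
  calc C * rho x ^ m ≤ |C| * rho x ^ m := by gcongr; exact le_abs_self C
    _ ≤ |C| * rho x ^ n := by
      gcongr ?_ * ?_
      exact pow_le_pow_of_le_one this.le (rho_le_one x) h

lemma BB.pow0 {f : E3 → ℝ} (hf : BB 0 f) (k : ℕ) : BB 0 (fun x => f x ^ k) := by
  induction k with
  | zero => simpa using BB.const 1
  | succ k ih => simpa only [pow_succ] using ih.mul hf

lemma BB_rho : BB 1 rho := ⟨continuous_rho, 1, fun x => by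
  rw [abs_of_pos (rho_pos x)]; simp⟩

lemma BB_rho_pow (n : ℕ) : BB n (fun x => rho x ^ n) := ⟨continuous_rho.pow n, 1, fun x => by
  rw [abs_of_pos (pow_pos (rho_pos x) n)]; simp⟩

lemma BB.div_rho {n : ℕ} {f : E3 → ℝ} (hf : BB (n + 1) f) : BB n (fun x => f x / rho x) := by
  obtain ⟨cf, C, hC⟩ := hf
  refine ⟨cf.div continuous_rho fun x => (rho_pos x).ne', C, fun x => ?_⟩
  rw [abs_div, abs_of_pos (rho_pos x), div_le_iff₀ (rho_pos x)]
  exact (hC x).trans_eq (by ring)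

lemma BB.integrable {f : E3 → ℝ} (hf : BB 4 f) : Integrable f := by
  obtain ⟨cf, C, hC⟩ := hf
  exact integrable_of_le_rho4 cf C hC

lemma BB.integrable_sq {f : E3 → ℝ} (hf : BB 2 f) : Integrable (fun x => f x ^ 2) := by
  simpa only [pow_two] using (hf.mul hf).integrable

lemma integrable_mul_of_sq {u v : E3 → ℝ} (hu : Continuous u) (hv : Continuous v)
    (hu2 : Integrable (fun x => u x ^ 2)) (hv2 : Integrable (fun x => v x ^ 2)) :
    Integrable (fun x => u x * v x) := by
  refine (hu2.add hv2).mono' (hu.mul hv).aestronglyMeasurable (ae_of_all _ fun x => ?_)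
  rw [Real.norm_eq_abs, abs_mul, Pi.add_apply, ← sq_abs (u x), ← sq_abs (v x)]
  nlinarith [sq_nonneg (|u x| - |v x|), sq_nonneg (|u x|), sq_nonneg (|v x|)]

lemma continuous_sg (a : ℝ) (b : E3) : Continuous (sg a b) := (contDiff_sg a b (n := 0)).continuous

lemma sg_sq_le (a : ℝ) (b x : E3) : sg a b x ^ 2 ≤ a ^ 2 + ‖b‖ ^ 2 := by
  have h := grad_sg_sq a b x
  have h0 : 0 ≤ ∑ i, pd i (sg a b) x ^ 2 := Finset.sum_nonneg fun i _ => sq_nonneg _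
  have : 0 < rho x ^ 4 := pow_pos (rho_pos x) 4
  by_contra hc
  push Not at hc
  nlinarith

lemma BB_sg (a : ℝ) (b : E3) : BB 0 (sg a b) :=
  ⟨continuous_sg a b, Real.sqrt (a ^ 2 + ‖b‖ ^ 2), fun x => by
    rw [pow_zero, mul_one]; exact Real.abs_le_sqrt (sg_sq_le a b x)⟩

lemma BB_pd_sg (a : ℝ) (b : E3) (i : Fin 3) : BB 2 (pd i (sg a b)) := by
  refine ⟨(pd_contDiff (n := 0) (contDiff_sg a b) i).continuous, 2 * Real.sqrt (a ^ 2 + ‖b‖ ^ 2), fun x => ?_⟩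
  have h := grad_sg_sq a b x
  have h1 : pd i (sg a b) x ^ 2 ≤ ∑ i, pd i (sg a b) x ^ 2 :=
    Finset.single_le_sum (f := fun i => pd i (sg a b) x ^ 2) (fun i _ => sq_nonneg _) (Finset.mem_univ i)
  have : 0 < rho x ^ 4 := pow_pos (rho_pos x) 4
  refine abs_le_of_sq_le_sq ?_ (by have := rho_pos x; positivity)
  have e : (2 * Real.sqrt (a ^ 2 + ‖b‖ ^ 2) * rho x ^ 2) ^ 2 = 4 * rho x ^ 4 * (a ^ 2 + ‖b‖ ^ 2) := by
    rw [mul_pow, mul_pow, Real.sq_sqrt (by positivity)]; ring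
  rw [e]
  nlinarith [sq_nonneg (sg a b x)]

lemma BB_pd_rho (i : Fin 3) : BB 2 (pd i rho) := by
  refine ⟨(pd_contDiff (n := 0) contDiff_rho i).continuous, 1, fun x => ?_⟩
  have hp := rho_pos x
  rw [pd_rho, abs_mul, abs_neg, abs_of_pos (pow_pos hp 3), one_mul]
  calc rho x ^ 3 * |x i| ≤ rho x ^ 3 * ‖x‖ := by gcongr; exact abs_coord_le x i
    _ = rho x ^ 2 * (rho x * ‖x‖) := by ring
    _ ≤ rho x ^ 2 * 1 := by gcongr; exact rho_norm_le x
    _ = _ := by ring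

lemma BB_sg_sub (a : ℝ) (b : E3) : BB 1 (fun x => sg a b x - a) := by
  refine ⟨(continuous_sg a b).sub continuous_const, 2 * (‖b‖ + |a|), fun x => ?_⟩
  have hp := rho_pos x
  have hr := rho_norm_le x
  have hr1 := rho_le_one x
  show |a + 2 * rho x ^ 2 * (inner ℝ b x - a) - a| ≤ _
  rw [add_sub_cancel_left, abs_mul, abs_mul, abs_of_pos (pow_pos hp 2), abs_two]
  calc 2 * rho x ^ 2 * |inner ℝ b x - a| ≤ 2 * rho x ^ 2 * (‖b‖ * ‖x‖ + |a|) := by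
        gcongr; exact (abs_sub _ _).trans (by gcongr; exact abs_real_inner_le_norm b x)
    _ = 2 * rho x * (‖b‖ * (rho x * ‖x‖) + |a| * rho x) := by ring
    _ ≤ 2 * rho x * (‖b‖ * 1 + |a| * 1) := by gcongr
    _ = _ := by ring

lemma BB_sg_pow_sub (a : ℝ) (b : E3) (k : ℕ) : BB 1 (fun x => sg a b x ^ k - a ^ k) := by
  induction k with
  | zero => simpa using (BB.const 0).mul BB_rho
  | succ k ih =>
    have := ((BB_sg a b).mul ih).add ((BB_sg_sub a b).const_mul (a ^ k))
    simp only [zero_add] at this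
    convert this using 2 with x
    ring

lemma BB_pd_sg_pow (a : ℝ) (b : E3) (k : ℕ) (i : Fin 3) : BB 2 (pd i (fun x => sg a b x ^ k)) := by
  have h := (((BB_sg a b).pow0 (k-1)).mul (BB_pd_sg a b i)).const_mul k
  rw [zero_add] at h
  convert h using 1
  funext x
  rw [pd_pow k (diff_sg a b x)]; ring

/-- the function `L σ^k` -/
def Lf (k : ℕ) (a : ℝ) (b x : E3) : ℝ := (3 + 4 * (k:ℝ) * (k + 2)) * sg a b x ^ k
  - 4 * (k:ℝ) * (k - 1) * (a ^ 2 + ‖b‖ ^ 2) * sg a b x ^ (k - 2)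

lemma BB_Lf (k : ℕ) (a : ℝ) (b : E3) : BB 0 (Lf k a b) :=
  (((BB_sg a b).pow0 k).const_mul _).sub (((BB_sg a b).pow0 (k - 2)).const_mul _)

lemma lap_f (k : ℕ) (a : ℝ) (b x : E3) :
    lap (fun y => rho y * sg a b y ^ k) x = - (rho x ^ 5 * Lf k a b x) := by
  have := lap_rho_sg_pow a b x k
  unfold Lf; linarith

lemma contDiff_f (k : ℕ) (a : ℝ) (b : E3) {n} : ContDiff ℝ n (fun y => rho y * sg a b y ^ k) :=
  contDiff_rho.mul ((contDiff_sg a b).pow k)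

lemma BB_pd_f (k : ℕ) (a : ℝ) (b : E3) (i : Fin 3) : BB 2 (pd i (fun y => rho y * sg a b y ^ k)) := by
  have h := ((BB_pd_rho i).mul ((BB_sg a b).pow0 k)).add ((BB_rho.mul (BB_pd_sg_pow a b k i)).mono (by norm_num))
  convert h using 1
  funext x
  rw [pd_mul (g := fun y => sg a b y ^ k) (diff_rho x) ((diff_sg a b x).pow k)]
  ring

lemma L_symm (k k' : ℕ) (a a' : ℝ) (b b' : E3) :
    ∫ x, (rho x ^ 3 * Lf k a b x) * (rho x ^ 3 * sg a' b' x ^ k')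
      = ∫ x, (rho x ^ 3 * sg a b x ^ k) * (rho x ^ 3 * Lf k' a' b' x) := by
  have hf : ∀ k a b, BB 1 (fun y => rho y * sg a b y ^ k) := fun k a b => BB_rho.mul ((BB_sg a b).pow0 k)
  have hl : ∀ k a b, BB 5 (lap (fun y => rho y * sg a b y ^ k)) := fun k a b => by
    have := ((BB_rho_pow 5).mul (BB_Lf k a b)).const_mul (-1)
    convert this using 1
    funext x; rw [lap_f]; ring
  have g := green (contDiff_f k' a' b') (contDiff_f k a b)
    (fun i => (BB_rho.mul ((hf k' a' b').mul (BB_pd_f k a b i))).integrable)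
    (fun i => (BB_rho.mul ((hf k a b).mul (BB_pd_f k' a' b' i))).integrable)
    (((hf k' a' b').mul (hl k a b)).mono (by norm_num)).integrable
    (((hf k a b).mul (hl k' a' b')).mono (by norm_num)).integrable
  simp only [lap_f] at g
  calc _ = - ∫ x, (rho x * sg a' b' x ^ k') * - (rho x ^ 5 * Lf k a b x) := by
        rw [← integral_neg]; congr 1; funext x; ring
    _ = _ := by rw [g, ← integral_neg]; congr 1; funext x; ring

section weak
variable {α B : ℝ}

lemma weak_h (hα : α ∈ Ioo (0:ℝ) 3) (hBpos : 0 < B)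
    (hB : ∀ x : E3, B * ∫ y : E3, rho y ^ (6 - α) / ‖x - y‖ ^ α = rho x ^ α)
    {h : E3 → ℝ} (hreg : ContDiff ℝ 2 h)
    (hfin : Integrable (fun x : E3 => ‖fderiv ℝ h x‖ ^ 2))
    (heq : ∀ x : E3, -(lap h x) =
      3 * ((6 - α) * B * (∫ y : E3, rho y ^ (5 - α) * h y / ‖x - y‖ ^ α) * rho x ^ (5 - α)
      + (5 - α) * rho x ^ 4 * h x))
    (k : ℕ) (a : ℝ) (b : E3) :
    ∫ x, (rho x ^ 2 * h x) * (rho x ^ 3 * Lf k a b x) =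
      3 * (6 - α) * QQ α B (fun x => rho x ^ 2 * h x) (fun x => rho x ^ 3 * sg a b x ^ k)
      + 3 * (5 - α) * ∫ x, (rho x ^ 2 * h x) * (rho x ^ 3 * sg a b x ^ k) := by
  have hch : Continuous h := hreg.continuous
  set u : E3 → ℝ := fun x => rho x ^ 2 * h x with hu
  have cu : Continuous u := (continuous_rho.pow 2).mul hch
  have u2 : Integrable (fun x => u x ^ 2) := by
    refine (hardy (hreg.of_le (by norm_num)) hfin).congr (ae_of_all _ fun x => ?_)
    simp only [hu]; ring
  have ui : ∀ {g : E3 → ℝ}, BB 2 g → Integrable (fun x => u x * g x) := fun hg =>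
    integrable_mul_of_sq cu hg.1 u2 hg.integrable_sq
  have dhi : ∀ i, Continuous (pd i h) ∧ Integrable (fun x => pd i h x ^ 2) := by
    intro i
    have c : Continuous (pd i h) := (pd_contDiff (n := 1) hreg i).continuous
    refine ⟨c, hfin.mono' (c.pow 2).aestronglyMeasurable (ae_of_all _ fun x => ?_)⟩
    have : |pd i h x| ≤ ‖fderiv ℝ h x‖ := by
      have := (fderiv ℝ h x).le_opNorm (EuclideanSpace.single i 1)
      simpa [pd] using this
    rw [Real.norm_eq_abs, abs_of_nonneg (sq_nonneg _), ← sq_abs (pd i h x)]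
    gcongr
  set p : E3 → ℝ := fun x => sg a b x ^ k - a ^ k * sg 1 0 x with hp
  have pB : BB 1 p := by
    have := (BB_sg_pow_sub a b k).sub ((BB_sg_sub 1 0).const_mul (a ^ k))
    convert this using 1
    funext x; simp only [hp]; ring
  have pC : ContDiff ℝ 2 p := ((contDiff_sg a b).pow k).sub (contDiff_const.mul (contDiff_sg 1 0))
  have pP : ∀ i, BB 2 (pd i p) := by
    intro i
    have := (BB_pd_sg_pow a b k i).sub ((BB_pd_sg 1 0 i).const_mul (a ^ k))
    convert this using 1
    funext x
    rw [hp, pd_sub (f := fun y => sg a b y ^ k) (g := fun y => a ^ k * sg 1 0 y) ((diff_sg a b x).pow k) ((diff_sg 1 0 x).const_mul _), pd_const_mul _ (diff_sg 1 0 x)]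
  set ψ : E3 → ℝ := fun x => rho x * p x with hψ
  have ψC : ContDiff ℝ 2 ψ := contDiff_rho.mul pC
  have ψB : BB 2 ψ := BB_rho.mul pB
  have ψP : ∀ i, BB 3 (pd i ψ) := by
    intro i
    have := ((BB_pd_rho i).mul pB).add (BB_rho.mul (pP i))
    convert this using 1
    funext x
    rw [hψ, pd_mul (diff_rho x) (pC.differentiable (by norm_num) x)]; ring
  have ψL : ∀ x, lap ψ x = - (rho x ^ 5 * (Lf k a b x - a ^ k * (15 * sg 1 0 x))) := by
    intro x
    have e : ψ = fun y => rho y * sg a b y ^ k + (- a ^ k) * (rho y * sg 1 0 y ^ 1) := by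
      funext y; simp only [hψ, hp]; ring
    rw [e, lap_add (contDiff_f k a b) (contDiff_const.mul (contDiff_f 1 1 0)), lap_const_mul _ (contDiff_f 1 1 0),
      lap_f, lap_f]
    simp only [Lf]; push_cast; ring
  have v3 : ∀ {g : E3 → ℝ}, BB 0 g → BB 2 (fun x => rho x ^ 3 * g x) := fun hg =>
    ((BB_rho_pow 3).mul hg).mono (by norm_num)
  have vB : BB 2 (fun x => rho x ^ 3 * p x) := v3 (pB.mono (by norm_num))
  obtain ⟨fi, fe⟩ := QQ_fubini hBpos hB cu u2 vB.1 vB.integrable_sq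
  have hl : ∀ x, ψ x * lap h x = - (3 * (6 - α) * (rho x ^ 3 * p x * ∫ y, KK α B x y * u y)
      + 3 * (5 - α) * (u x * (rho x ^ 3 * p x))) := by
    intro x
    have e := heq x
    have e1 : ∫ y, KK α B x y * u y = B * rho x ^ (3 - α) * ∫ y : E3, rho y ^ (5 - α) * h y / ‖x - y‖ ^ α := by
      simp only [hu]
      simp_rw [KK_rho2]
      rw [integral_const_mul]
    have e2 : rho x ^ (5 - α) = rho x ^ (3 - α) * rho x ^ 2 := by
      rw [rpow_shift]; congr 1; push_cast; ring
    rw [e1]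
    rw [e2] at e
    simp only [hψ, hu]
    linear_combination (- rho x * p x) * e
  have g := green hreg ψC
    (fun i => by
      refine (ui (BB.div_rho (ψP i))).congr (ae_of_all _ fun x => ?_)
      have := (rho_pos x).ne'
      simp only [hu]; field_simp)
    (fun i => by
      have hb : BB 2 (fun x => rho x * ψ x) := (BB_rho.mul ψB).mono (by norm_num)
      refine (integrable_mul_of_sq hb.1 (dhi i).1 hb.integrable_sq (dhi i).2).congr (ae_of_all _ fun x => ?_)
      ring)
    (by
      have hb : BB 2 (fun x => - (rho x ^ 3 * (Lf k a b x - a ^ k * (15 * sg 1 0 x)))) := by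
        have := (v3 ((BB_Lf k a b).sub (((BB_sg 1 0).const_mul 15).const_mul (a^k)))).const_mul (-1)
        convert this using 2 with x
        ring
      refine (ui hb).congr (ae_of_all _ fun x => ?_)
      simp only [ψL, hu]; ring)
    (by
      refine (((fi.const_mul (3 * (6 - α))).add ((ui vB).const_mul (3 * (5 - α)))).neg).congr (ae_of_all _ fun x => ?_)
      simp only [hl, Pi.neg_apply, Pi.add_apply])
  have s1 : BB 2 (fun x => rho x ^ 3 * Lf k a b x) := v3 (BB_Lf k a b)
  have s2 : BB 2 (fun x => rho x ^ 3 * sg 1 0 x) := v3 (BB_sg 1 0)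
  have s3 : BB 2 (fun x => rho x ^ 3 * sg a b x ^ k) := v3 ((BB_sg a b).pow0 k)
  have gl : ∫ x, h x * lap ψ x = - (∫ x, u x * (rho x ^ 3 * Lf k a b x)) + 15 * a ^ k * ∫ x, u x * (rho x ^ 3 * sg 1 0 x) := by
    rw [← integral_const_mul, neg_add_eq_sub, ← integral_sub ((ui s2).const_mul _) (ui s1)]
    congr 1; funext x; rw [ψL]; simp only [hu]; ring
  have gr : ∫ x, ψ x * lap h x = -(3 * (6 - α) * QQ α B u (fun x => rho x ^ 3 * p x)
      + 3 * (5 - α) * ∫ x, u x * (rho x ^ 3 * p x)) := by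
    rw [fe, ← integral_const_mul, ← integral_const_mul, ← integral_add (fi.const_mul _) ((ui vB).const_mul _),
      ← integral_neg]
    congr 1; funext x; rw [hl]
  have ep : (fun x => rho x ^ 3 * p x) = fun x => rho x ^ 3 * sg a b x ^ k + (- a ^ k) * (rho x ^ 3 * sg 1 0 x) := by
    funext x; simp only [hp]; ring
  have eq1 := QQ_add_right hBpos hB cu u2 s3.1 s3.integrable_sq s2.1 s2.integrable_sq (- a ^ k)
  have eq2 := QQ_sg hα hBpos hB cu u2 1 0 s2.integrable_sq
  have eq3 : ∫ x, u x * (rho x ^ 3 * p x) = (∫ x, u x * (rho x ^ 3 * sg a b x ^ k)) + (- a ^ k) * ∫ x, u x * (rho x ^ 3 * sg 1 0 x) := by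
    rw [← integral_const_mul, ← integral_add (ui s3) ((ui s2).const_mul _)]
    congr 1; funext x; simp only [hp]; ring
  rw [gl, gr, eq3, ep, eq1, eq2] at g
  have h6 : 6 - α ≠ 0 := by linarith [hα.2]
  have e6 : 3 * (6 - α) * (α / (6 - α)) = 3 * α := by field_simp
  linear_combination -g - (a ^ k * ∫ x, u x * (rho x ^ 3 * sg 1 0 x)) * e6

end weak

end part6

section part7

lemma exp_zero {w : E3 → ℝ} (hwi : Integrable w)
    (hz : ∀ (k : ℕ) (a : ℝ) (b : E3), ∫ x, w x * sg a b x ^ k = 0) (a : ℝ) (b : E3) :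
    ∫ x, (w x : ℂ) * Complex.exp (sg a b x * Complex.I) = 0 := by
  set c := Real.sqrt (a ^ 2 + ‖b‖ ^ 2) with hc
  have hsc : ∀ x, |sg a b x| ≤ c := fun x => Real.abs_le_sqrt (sg_sq_le a b x)
  have hS : Summable (fun n : ℕ => c ^ n / (n.factorial : ℝ)) := Real.summable_pow_div_factorial c
  have key := hasSum_integral_of_dominated_convergence (μ := (volume : Measure E3))
    (F := fun (n : ℕ) x => (w x : ℂ) * ((sg a b x * Complex.I) ^ n / (n.factorial : ℂ)))
    (f := fun x => (w x : ℂ) * Complex.exp (sg a b x * Complex.I))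
    (fun n x => |w x| * (c ^ n / (n.factorial : ℝ)))
    (fun n => by
      refine (hwi.ofReal (𝕜 := ℂ)).aestronglyMeasurable.mul ?_
      have := continuous_sg a b
      exact Continuous.aestronglyMeasurable (by fun_prop))
    (fun n => ae_of_all _ fun x => by
      rw [norm_mul, norm_div, norm_pow, norm_mul, Complex.norm_I, mul_one, Complex.norm_real,
        Complex.norm_real, Complex.norm_natCast, Real.norm_eq_abs, Real.norm_eq_abs]
      gcongr
      exact hsc x)
    (ae_of_all _ fun x => hS.mul_left _)
    (by simp_rw [tsum_mul_left]; exact hwi.abs.mul_const _)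
    (ae_of_all _ fun x => (by
      have := NormedSpace.expSeries_div_hasSum_exp (sg a b x * Complex.I)
      rw [← Complex.exp_eq_exp_ℂ] at this
      exact this.mul_left _))
  have h0 : ∀ n : ℕ, ∫ x, (w x : ℂ) * ((sg a b x * Complex.I) ^ n / (n.factorial : ℂ)) = 0 := by
    intro n
    have e : ∀ x, (w x : ℂ) * ((sg a b x * Complex.I) ^ n / (n.factorial : ℂ)) =
        (Complex.I ^ n / (n.factorial : ℂ)) * ((w x * sg a b x ^ n : ℝ) : ℂ) := by
      intro x; push_cast; ring
    simp_rw [e]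
    rw [integral_const_mul, integral_complex_ofReal, hz n a b]
    simp
  simp_rw [h0] at key
  exact (hasSum_zero.unique key).symm

def SS (x : E3) : ℝ × E3 := (1 - 2 * rho x ^ 2, (2 * rho x ^ 2) • x)

lemma SS_cont : Continuous SS := by
  have := continuous_rho
  unfold SS; fun_prop

lemma SS_left (x : E3) : (fun p : ℝ × E3 => (1 - p.1)⁻¹ • p.2) (SS x) = x := by
  have h := rho_pos x
  simp only [SS, sub_sub_cancel, smul_smul]
  rw [inv_mul_cancel₀ (by positivity), one_smul]

theorem dense_fn {w : E3 → ℝ} (hwm : Measurable w) (hwi : Integrable w)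
    (hz : ∀ (k : ℕ) (a : ℝ) (b : E3), ∫ x, w x * sg a b x ^ k = 0) : w =ᵐ[volume] 0 := by
  set m1 : Measure E3 := volume.withDensity (fun x => ENNReal.ofReal (w x)) with hm1
  set m2 : Measure E3 := volume.withDensity (fun x => ENNReal.ofReal (-w x)) with hm2
  have f1 : IsFiniteMeasure m1 := isFiniteMeasure_withDensity_ofReal hwi.2
  have f2 : IsFiniteMeasure m2 := isFiniteMeasure_withDensity_ofReal hwi.neg.2
  have hSm : Measurable SS := SS_cont.measurable
  have hmap : m1.map SS = m2.map SS := by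
    refine Measure.ext_of_charFunDual (funext fun L => ?_)
    obtain ⟨a, b, hab⟩ : ∃ a b, ∀ x, L (SS x) = sg a b x := by
      refine ⟨L (1, 0), (InnerProductSpace.toDual ℝ E3).symm (L.comp (ContinuousLinearMap.inr ℝ ℝ E3)), fun x => ?_⟩
      rw [sg, InnerProductSpace.toDual_symm_apply]
      have e : SS x = (1 - 2 * rho x ^ 2) • ((1:ℝ), (0:E3)) + (2 * rho x ^ 2) • ((0:ℝ), x) := by
        simp [SS]
      rw [e, map_add, map_smul, map_smul]
      simp only [smul_eq_mul, ContinuousLinearMap.comp_apply, ContinuousLinearMap.inr_apply]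
      ring
    rw [charFunDual_apply, charFunDual_apply, integral_map hSm.aemeasurable
      (Continuous.aestronglyMeasurable (by fun_prop)),
      integral_map hSm.aemeasurable (Continuous.aestronglyMeasurable (by fun_prop))]
    simp_rw [hab]
    rw [hm1, hm2, integral_withDensity_eq_integral_toReal_smul (by fun_prop) (by simp),
      integral_withDensity_eq_integral_toReal_smul (by fun_prop) (by simp), ← sub_eq_zero]
    have hb : ∀ v : E3 → ℝ, Integrable v →
        Integrable (fun x => (ENNReal.ofReal (v x)).toReal • Complex.exp (sg a b x * Complex.I)) := by
      intro v hv
      have h1 : Integrable (fun x => (ENNReal.ofReal (v x)).toReal) := by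
        refine hv.pos_part.congr (ae_of_all _ fun x => ?_)
        simp [ENNReal.toReal_ofReal']
      have h2 : Continuous (fun x => Complex.exp (sg a b x * Complex.I)) := by
        have := continuous_sg a b
        fun_prop
      refine h1.norm.mono (h1.aestronglyMeasurable.smul h2.aestronglyMeasurable) (ae_of_all _ fun x => ?_)
      rw [norm_smul, Complex.norm_exp_ofReal_mul_I]; simp
    rw [← integral_sub (hb w hwi) (hb (fun x => -w x) hwi.neg), ← exp_zero hwi hz a b]
    congr 1; funext x
    rw [← sub_smul, ENNReal.toReal_ofReal', ENNReal.toReal_ofReal', max_zero_sub_eq_self, Complex.real_smul]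
  have hg : Measurable (fun p : ℝ × E3 => (1 - p.1)⁻¹ • p.2) := by fun_prop
  have hm : m1 = m2 := by
    have := congrArg (Measure.map (fun p : ℝ × E3 => (1 - p.1)⁻¹ • p.2)) hmap
    rw [Measure.map_map hg hSm, Measure.map_map hg hSm] at this
    have e : (fun p : ℝ × E3 => (1 - p.1)⁻¹ • p.2) ∘ SS = id := funext SS_left
    rwa [e, Measure.map_id, Measure.map_id] at this
  rw [hm1, hm2, withDensity_eq_iff_of_sigmaFinite (by fun_prop) (by fun_prop)] at hm
  filter_upwards [hm] with x hx
  rcases le_total 0 (w x) with h | h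
  · rw [ENNReal.ofReal_of_nonpos (by linarith : -w x ≤ 0), ENNReal.ofReal_eq_zero] at hx
    exact le_antisymm hx h
  · rw [ENNReal.ofReal_of_nonpos h, eq_comm, ENNReal.ofReal_eq_zero] at hx
    simp only [Pi.zero_apply]; linarith

end part7

section part8

open scoped BoundedContinuousFunction

abbrev HL : Type := Lp ℝ 2 (volume : Measure E3)

lemma memLp_of_sq {f : E3 → ℝ} (hf : Continuous f) (h2 : Integrable (fun x => f x ^ 2)) :
    MemLp f 2 (volume : Measure E3) :=
  (memLp_two_iff_integrable_sq hf.aestronglyMeasurable).mpr h2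

lemma inner_toLp {f g : E3 → ℝ} (hf : MemLp f 2 (volume : Measure E3)) (hg : MemLp g 2 (volume : Measure E3)) :
    inner ℝ (hf.toLp f) (hg.toLp g) = ∫ x, f x * g x := by
  rw [L2.inner_def]
  refine integral_congr_ae ?_
  filter_upwards [hf.coeFn_toLp, hg.coeFn_toLp] with x h1 h2
  rw [h1, h2]; simp [mul_comm]

lemma BB_bcf (f : E3 →ᵇ ℝ) : BB 0 f := ⟨f.continuous, ‖f‖, fun x => by
  simpa using f.norm_coe_le_norm x⟩

lemma BB_rho3 (f : E3 →ᵇ ℝ) : BB 2 (fun x => rho x ^ 3 * f x) :=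
  ((BB_rho_pow 3).mul (BB_bcf f)).mono (by norm_num)

lemma memLp_rho3 (f : E3 →ᵇ ℝ) : MemLp (fun x => rho x ^ 3 * f x) 2 (volume : Measure E3) :=
  memLp_of_sq (BB_rho3 f).1 (BB_rho3 f).integrable_sq

def Psi : (E3 →ᵇ ℝ) →ₗ[ℝ] HL where
  toFun f := (memLp_rho3 f).toLp _
  map_add' f g := by
    rw [← MemLp.toLp_add]
    refine MemLp.toLp_congr _ _ (ae_of_all _ fun x => ?_)
    simp [mul_add]
  map_smul' c f := by
    rw [RingHom.id_apply, ← MemLp.toLp_const_smul]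
    refine MemLp.toLp_congr _ _ (ae_of_all _ fun x => ?_)
    simp; ring

def sgB : (ℝ × E3) →ₗ[ℝ] (E3 →ᵇ ℝ) where
  toFun v := BoundedContinuousFunction.ofNormedAddCommGroup (sg v.1 v.2) (continuous_sg _ _)
    (Real.sqrt (v.1 ^ 2 + ‖v.2‖ ^ 2)) (fun x => Real.abs_le_sqrt (sg_sq_le _ _ x))
  map_add' v w := by
    ext x
    simp [sg, inner_add_left]; ring
  map_smul' c v := by
    ext x
    simp [sg, inner_smul_left]; ring

lemma sgB_apply (v : ℝ × E3) (x : E3) : sgB v x = sg v.1 v.2 x := rfl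

def ek (k : ℕ) (v : ℝ × E3) : HL := Psi (sgB v ^ k)

def nvv (v : ℝ × E3) : ℝ := v.1 ^ 2 + ‖v.2‖ ^ 2

def LB (kv : ℕ × (ℝ × E3)) : E3 →ᵇ ℝ := (3 + 4 * (kv.1:ℝ) * (kv.1 + 2)) • sgB kv.2 ^ kv.1
  - (4 * (kv.1:ℝ) * (kv.1 - 1) * nvv kv.2) • sgB kv.2 ^ (kv.1 - 2)

lemma LB_apply (kv : ℕ × (ℝ × E3)) (x : E3) : LB kv x = Lf kv.1 kv.2.1 kv.2.2 x := by
  simp [LB, Lf, nvv, sgB_apply]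

lemma genL_eq (kv : ℕ × (ℝ × E3)) : genL ek nvv kv = Psi (LB kv) := by
  simp only [genL, LB, map_sub, map_smul, ek]

lemma inner_Psi (f g : E3 →ᵇ ℝ) : inner ℝ (Psi f) (Psi g) = ∫ x, (rho x ^ 3 * f x) * (rho x ^ 3 * g x) :=
  inner_toLp (memLp_rho3 f) (memLp_rho3 g)

lemma ek_sym (p q : ℕ × (ℝ × E3)) :
    inner ℝ (genL ek nvv p) (genE ek q) = inner ℝ (genE ek p) (genL ek nvv q) := by
  rw [genL_eq, genL_eq, genE, genE, ek, ek, inner_Psi, inner_Psi]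
  simp only [LB_apply, BoundedContinuousFunction.coe_pow, Pi.pow_apply, sgB_apply]
  exact L_symm _ _ _ _ _ _

lemma ek_fd (N : ℕ) : FiniteDimensional ℝ (WN ek N) := by
  set M : Submodule ℝ (E3 →ᵇ ℝ) := 1 ⊔ LinearMap.range sgB with hM
  have hfg : M.FG := by
    refine Submodule.FG.sup ?_ ?_
    · rw [Submodule.one_eq_span]; exact Submodule.fg_span_singleton _
    · exact Module.Finite.iff_fg.mp inferInstance
  have h1 : (1 : Submodule ℝ (E3 →ᵇ ℝ)) ≤ M := le_sup_left
  have hle : WN ek N ≤ (M ^ N).map Psi := by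
    refine Submodule.span_le.mpr ?_
    rintro _ ⟨⟨k, v⟩, hk, rfl⟩
    refine Submodule.mem_map_of_mem ?_
    have : sgB v ^ k ∈ M ^ k := Submodule.pow_mem_pow M ((le_sup_right : _ ≤ M) ⟨v, rfl⟩) k
    have h0 : (1 : E3 →ᵇ ℝ) ∈ M := Submodule.one_le.mp h1
    have hall : ∀ d : ℕ, sgB v ^ k ∈ M ^ (k + d) := by
      intro d
      induction d with
      | zero => exact this
      | succ d ih =>
        have h2 := Submodule.mul_mem_mul ih h0
        rw [mul_one] at h2
        rw [← add_assoc, Submodule.pow_succ]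
        exact h2
    have hN : k + (N - k) = N := Nat.add_sub_cancel' hk
    have h3 := hall (N - k)
    rw [hN] at h3
    exact h3
  have : FiniteDimensional ℝ ((M ^ N).map Psi) := Module.Finite.iff_fg.mpr ((hfg.pow N).map Psi)
  exact Submodule.finiteDimensional_of_le hle

lemma ek_dense (u : HL) (hu : ∀ k v, inner ℝ u (ek k v) = 0) : u = 0 := by
  have hum : Measurable u := (Lp.stronglyMeasurable u).measurable
  have h3 : BB 2 (fun x => rho x ^ 3) := (BB_rho_pow 3).mono (by norm_num)
  have hu2 : MemLp u 2 (volume : Measure E3) := Lp.memLp u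
  have hi : Integrable (fun x => u x * rho x ^ 3) :=
    hu2.integrable_mul (memLp_of_sq h3.1 h3.integrable_sq)
  have := dense_fn (w := fun x => u x * rho x ^ 3) (hum.mul (continuous_rho.pow 3).measurable) hi (by
    intro k a b
    have e : u = hu2.toLp u := (Lp.toLp_coeFn u hu2).symm
    have h := hu k (a, b)
    rw [e] at h
    have h' : inner ℝ (hu2.toLp u) (ek k (a, b)) = ∫ x, u x * (rho x ^ 3 * (sgB (a, b) ^ k) x) :=
      inner_toLp hu2 (memLp_rho3 (sgB (a, b) ^ k))
    rw [← h, h']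
    congr 1; funext x
    simp only [BoundedContinuousFunction.coe_pow, Pi.pow_apply, sgB_apply]
    ring)
  rw [Lp.eq_zero_iff_ae_eq_zero]
  filter_upwards [this] with x hx
  have := (pow_pos (rho_pos x) 3).ne'
  simpa [this] using hx

section core
variable {α B : ℝ}

lemma weak_sg (hα : α ∈ Ioo (0:ℝ) 3)
    (hBpos : 0 < B)
    (hB : ∀ x : E3, B * ∫ y : E3, rho y ^ (6 - α) / ‖x - y‖ ^ α = rho x ^ α)
    (v : ℝ × E3) (k : ℕ) (a : ℝ) (b : E3) :
    ∫ x, (rho x ^ 3 * sg v.1 v.2 x) * (rho x ^ 3 * Lf k a b x) =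
      3 * (6 - α) * QQ α B (fun x => rho x ^ 3 * sg v.1 v.2 x) (fun x => rho x ^ 3 * sg a b x ^ k)
      + 3 * (5 - α) * ∫ x, (rho x ^ 3 * sg v.1 v.2 x) * (rho x ^ 3 * sg a b x ^ k) := by
  have h1 := L_symm 1 k v.1 a v.2 b
  simp only [pow_one] at h1
  rw [← h1]
  have s : BB 2 (fun x => rho x ^ 3 * sg v.1 v.2 x) := BB_rho3 (sgB v)
  have s' : BB 2 (fun x => rho x ^ 3 * sg a b x ^ k) := BB_rho3 (sgB (a, b) ^ k)
  rw [QQ_symm hBpos hB, QQ_sg hα hBpos hB s'.1 s'.integrable_sq _ _ s.integrable_sq]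
  have h6 : 6 - α ≠ 0 := by linarith [hα.2]
  have e6 : 3 * (6 - α) * (α / (6 - α)) = 3 * α := by field_simp
  rw [← mul_assoc, e6, ← integral_const_mul, ← integral_const_mul, ← integral_add]
  · congr 1; funext x
    simp only [Lf]; push_cast; ring
  · exact ((s'.mul s).integrable).const_mul _
  · exact ((s.mul s').integrable).const_mul _

theorem core (hα : α ∈ Ioo (0:ℝ) 3)
    (hBpos : 0 < B)
    (hB : ∀ x : E3, B * ∫ y : E3, rho y ^ (6 - α) / ‖x - y‖ ^ α = rho x ^ α)
    {h : E3 → ℝ} (hreg : ContDiff ℝ 2 h)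
    (hfin : Integrable (fun x : E3 => ‖fderiv ℝ h x‖ ^ 2))
    (heq : ∀ x : E3, -(lap h x) =
      3 * ((6 - α) * B * (∫ y : E3, rho y ^ (5 - α) * h y / ‖x - y‖ ^ α) * rho x ^ (5 - α)
      + (5 - α) * rho x ^ 4 * h x)) :
    ∃ a b, ∀ x, h x = rho x * sg a b x := by
  set u : E3 → ℝ := fun x => rho x ^ 2 * h x with hu
  have cu : Continuous u := (continuous_rho.pow 2).mul hreg.continuous
  have u2 : Integrable (fun x => u x ^ 2) := by
    refine (hardy (hreg.of_le (by norm_num)) hfin).congr (ae_of_all _ fun x => ?_)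
    simp only [hu]; ring
  have hum := memLp_of_sq cu u2
  set R := LinearMap.range (Psi ∘ₗ sgB)
  obtain ⟨v, hv⟩ := R.starProjection_apply_mem (hum.toLp u)
  have horth : ∀ v', inner ℝ (Psi (sgB v')) (hum.toLp u - Psi (sgB v)) = 0 := by
    intro v'
    have e : Psi (sgB v) = R.starProjection (hum.toLp u) := hv
    rw [e]
    exact (Submodule.mem_orthogonal _ _).mp (Submodule.sub_starProjection_mem_orthogonal _) _ ⟨v', rfl⟩
  set s : E3 → ℝ := fun x => rho x ^ 3 * sg v.1 v.2 x with hs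
  have sB : BB 2 s := BB_rho3 (sgB v)
  set g : E3 → ℝ := fun x => u x - s x with hg
  have cg : Continuous g := cu.sub sB.1
  have hgm : MemLp g 2 (volume : Measure E3) := hum.sub (memLp_rho3 (sgB v))
  have g2 : Integrable (fun x => g x ^ 2) := (memLp_two_iff_integrable_sq cg.aestronglyMeasurable).mp hgm
  have eG : hum.toLp u - Psi (sgB v) = hgm.toLp g := (MemLp.toLp_sub hum (memLp_rho3 (sgB v))).symm
  rw [eG] at horth
  set G : HL := hgm.toLp g with hG
  have innG : ∀ f : E3 →ᵇ ℝ, inner ℝ G (Psi f) = ∫ x, g x * (rho x ^ 3 * f x) := fun f =>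
    inner_toLp hgm (memLp_rho3 f)
  have weak : ∀ kv : ℕ × (ℝ × E3), inner ℝ G (Psi (LB kv)) =
      3 * (6 - α) * QQ α B g (fun x => rho x ^ 3 * (sgB kv.2 ^ kv.1) x)
      + 3 * (5 - α) * inner ℝ G (Psi (sgB kv.2 ^ kv.1)) := by
    rintro ⟨k, a, b⟩
    have t : BB 2 (fun x => rho x ^ 3 * (sgB (a, b) ^ k) x) := BB_rho3 _
    have w1 := weak_h hα hBpos hB hreg hfin heq k a b
    have w2 := weak_sg hα hBpos hB v k a b
    have q1 := QQ_add_right hBpos hB t.1 t.integrable_sq cu u2 sB.1 sB.integrable_sq (-1)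
    have q2 : (fun x => u x + -1 * s x) = g := by funext x; simp only [hg]; ring
    rw [q2] at q1
    rw [QQ_symm hBpos hB, QQ_symm hBpos hB (v := u), QQ_symm hBpos hB (v := s)] at q1
    have split : ∀ f : E3 →ᵇ ℝ, inner ℝ G (Psi f) =
        (∫ x, u x * (rho x ^ 3 * f x)) - ∫ x, s x * (rho x ^ 3 * f x) := by
      intro f
      rw [innG, ← integral_sub (integrable_mul_of_sq cu (BB_rho3 f).1 u2 (BB_rho3 f).integrable_sq)
        (integrable_mul_of_sq sB.1 (BB_rho3 f).1 sB.integrable_sq (BB_rho3 f).integrable_sq)]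
      congr 1; funext x; simp only [hg]; ring
    rw [split, split, q1]
    simp only [LB_apply, BoundedContinuousFunction.coe_pow, Pi.pow_apply, sgB_apply]
    rw [w1, w2]
    ring
  have h6 : 0 < 6 - α := by linarith [hα.2]
  have hG1 : ∀ k ≤ 1, ∀ v', inner ℝ G (ek k v') = 0 := by
    intro k hk v'
    rcases Nat.le_one_iff_eq_zero_or_eq_one.mp hk with rfl | rfl
    · have w := weak (0, v')
      rw [innG, innG] at w
      simp only [LB_apply, pow_zero, BoundedContinuousFunction.coe_one, Pi.one_apply, mul_one] at w
      rw [QQ_one hBpos hB cg g2 ((BB_rho_pow 3).mono (by norm_num : 2 ≤ 3)).integrable_sq] at w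
      have e : ∫ x, g x * (rho x ^ 3 * Lf 0 v'.1 v'.2 x) = 3 * ∫ x, g x * rho x ^ 3 := by
        rw [← integral_const_mul]; congr 1; funext x; simp [Lf]; ring
      rw [e] at w
      rw [ek, innG]
      simp only [pow_zero, BoundedContinuousFunction.coe_one, Pi.one_apply, mul_one]
      have : (30 - 6 * α) * ∫ x, g x * rho x ^ 3 = 0 := by linarith
      rcases mul_eq_zero.mp this with h | h
      · linarith [hα.2]
      · exact h
    · rw [ek, pow_one, real_inner_comm]; exact horth v'
  have hQ : ∀ p, inner ℝ G (iL ek nvv p) ≤ 3 * (6 - α) / 2 * (‖G‖ ^ 2 + ‖iE ek p‖ ^ 2)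
      + 3 * (5 - α) * inner ℝ G (iE ek p) := by
    intro p
    have ex : ∃ f F : E3 →ᵇ ℝ, iE ek p = Psi f ∧ iL ek nvv p = Psi F ∧
        inner ℝ G (Psi F) = 3 * (6 - α) * QQ α B g (fun x => rho x ^ 3 * f x)
        + 3 * (5 - α) * inner ℝ G (Psi f) := by
      induction p using Finsupp.induction_linear with
      | zero => exact ⟨0, 0, by simp, by simp, by simp [QQ]⟩
      | add p q hp hq =>
        obtain ⟨f, F, a1, a2, a3⟩ := hp
        obtain ⟨f', F', b1, b2, b3⟩ := hq
        refine ⟨f + f', F + F', by rw [map_add, map_add, a1, b1], by rw [map_add, map_add, a2, b2], ?_⟩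
        have q1 := QQ_add_right hBpos hB cg g2 (BB_rho3 f).1 (BB_rho3 f).integrable_sq
          (BB_rho3 f').1 (BB_rho3 f').integrable_sq 1
        have q2 : (fun x => rho x ^ 3 * (f + f') x) = fun x => rho x ^ 3 * f x + 1 * (rho x ^ 3 * f' x) := by
          funext x; simp; ring
        rw [q2, q1, map_add, map_add, inner_add_right, inner_add_right, a3, b3]; ring
      | single kv c =>
        refine ⟨c • sgB kv.2 ^ kv.1, c • LB kv, by simp [iE, genE, ek], by simp [iL, genL_eq], ?_⟩
        have q1 := QQ_add_right hBpos hB cg g2 (BB_rho3 0).1 (BB_rho3 0).integrable_sq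
          (BB_rho3 (sgB kv.2 ^ kv.1)).1 (BB_rho3 (sgB kv.2 ^ kv.1)).integrable_sq c
        have q2 : (fun x => rho x ^ 3 * (c • sgB kv.2 ^ kv.1) x) =
            fun x => rho x ^ 3 * (0 : E3 →ᵇ ℝ) x + c * (rho x ^ 3 * (sgB kv.2 ^ kv.1) x) := by
          funext x; simp; ring
        have q3 : QQ α B g (fun x => rho x ^ 3 * (0 : E3 →ᵇ ℝ) x) = 0 := by simp [QQ]
        rw [q2, q1, q3, map_smul, map_smul, inner_smul_right, inner_smul_right, weak kv]; ring
    obtain ⟨f, F, h1, h2, h3⟩ := ex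
    rw [h1, h2, h3]
    have hb := (QQ_int hBpos hB cg g2 (BB_rho3 f).1 (BB_rho3 f).integrable_sq).2
    have n1 : ‖G‖ ^ 2 = ∫ x, g x ^ 2 := by
      rw [← real_inner_self_eq_norm_sq, hG, inner_toLp]; simp only [pow_two]
    have n2 : ‖Psi f‖ ^ 2 = ∫ x, (rho x ^ 3 * f x) ^ 2 := by
      rw [← real_inner_self_eq_norm_sq, inner_Psi]; simp only [pow_two]
    rw [n1, n2]
    have := mul_le_mul_of_nonneg_left hb (by linarith : 0 ≤ 3 * (6 - α))
    linarith
  have hG0 := abstract_gap ek nvv ek_sym ek_fd ek_dense G hG1 (3 * (6 - α)) (3 * (5 - α))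
    (by linarith [hα.1]) hQ
  have hae : g =ᵐ[volume] 0 := by
    have h1 := hgm.coeFn_toLp
    have h2 : (G : E3 → ℝ) =ᵐ[volume] 0 := by rw [hG0]; exact Lp.coeFn_zero _ _ _
    exact h1.symm.trans h2
  have hg0 : g = 0 := (Continuous.ae_eq_iff_eq volume cg continuous_zero).mp hae
  refine ⟨v.1, v.2, fun x => ?_⟩
  have hx := congrFun hg0 x
  simp only [hg, hu, hs, Pi.zero_apply] at hx
  have hr : rho x ^ 2 ≠ 0 := (pow_pos (rho_pos x) 2).ne'
  have : rho x ^ 2 * (h x - rho x * sg v.1 v.2 x) = 0 := by linear_combination hx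
  rcases mul_eq_zero.mp this with h | h
  · exact absurd h hr
  · linarith
end core

end part8

section part9

section reduction
variable {μ : ℝ} (ξ : E3)

lemma bubble_scale (hμ : 0 < μ) (ξ x : E3) :
    bubble μ ξ (μ • x + ξ) = ((3:ℝ) ^ ((1:ℝ)/4) * μ ^ (-(1:ℝ)/2)) * rho x := by
  have h0 : (0:ℝ) < 1 + ‖x‖ ^ 2 := by positivity
  have e : μ / (μ ^ 2 + ‖μ • x + ξ - ξ‖ ^ 2) = μ⁻¹ * (1 + ‖x‖ ^ 2)⁻¹ := by
    rw [add_sub_cancel_right, norm_smul, Real.norm_eq_abs, abs_of_pos hμ]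
    field_simp
  rw [bubble, e, Real.mul_rpow (by positivity) (by positivity), rho, Real.sqrt_eq_rpow,
    Real.inv_rpow h0.le, Real.inv_rpow hμ.le, neg_div, Real.rpow_neg hμ.le]
  ring

lemma integral_scale (hμ : 0 < μ) (ξ x : E3) (α : ℝ) (g : E3 → ℝ) :
    ∫ y : E3, g y / ‖μ • x + ξ - y‖ ^ α =
      μ ^ (3 - α) * ∫ z : E3, g (μ • z + ξ) / ‖x - z‖ ^ α := by
  have h1 : ∀ y : E3, g (μ • y + ξ) / ‖x - y‖ ^ α =
      μ ^ α * (fun u : E3 => (fun z : E3 => g z / ‖μ • x + ξ - z‖ ^ α) (u + ξ)) (μ • y) := by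
    intro y
    have : μ • x + ξ - (μ • y + ξ) = μ • (x - y) := by rw [smul_sub]; abel
    simp only [this, norm_smul, Real.norm_eq_abs, abs_of_pos hμ]
    rw [Real.mul_rpow hμ.le (norm_nonneg _)]
    have := (Real.rpow_pos_of_pos hμ α).ne'
    rw [← mul_div_assoc, mul_div_mul_left _ _ this]
  simp_rw [h1]
  rw [integral_const_mul, Measure.integral_comp_smul volume (fun u : E3 => (fun z : E3 => g z / ‖μ • x + ξ - z‖ ^ α) (u + ξ)) μ, integral_add_right_eq_self (fun z : E3 => g z / ‖μ • x + ξ - z‖ ^ α)]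
  have : μ ^ (3 - α) = (μ ^ α)⁻¹ * μ ^ 3 := by
    rw [Real.rpow_sub hμ, div_eq_mul_inv]; norm_cast; ring
  have h2 := (Real.rpow_pos_of_pos hμ α).ne'
  rw [this]
  simp [abs_of_pos hμ]
  field_simp

lemma fderiv_scale {f : E3 → ℝ} (hf : Differentiable ℝ f) (x : E3) :
    fderiv ℝ (fun y => f (μ • y + ξ)) x = μ • fderiv ℝ f (μ • x + ξ) := by
  have h1 : HasFDerivAt (fun y : E3 => μ • y + ξ) (μ • ContinuousLinearMap.id ℝ E3) x :=
    ((hasFDerivAt_id x).const_smul μ).add_const ξ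
  have h2 := ((hf (μ • x + ξ)).hasFDerivAt).comp x h1
  have h3 := h2.fderiv
  rw [show (fun y => f (μ • y + ξ)) = f ∘ (fun y : E3 => μ • y + ξ) from rfl, h3]
  ext v
  simp

lemma lap_scale {h : E3 → ℝ} (hreg : ContDiff ℝ 2 h) (x : E3) :
    lap (fun y => h (μ • y + ξ)) x = μ ^ 2 * lap h (μ • x + ξ) := by
  have hd : Differentiable ℝ h := hreg.differentiable (by norm_num)
  rw [lap, lap, Finset.mul_sum]
  refine Finset.sum_congr rfl fun i _ => ?_
  have hd2 : Differentiable ℝ (fun y => fderiv ℝ h y (EuclideanSpace.single i 1)) := by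
    have : Differentiable ℝ (fderiv ℝ h) :=
      (hreg.fderiv_right (m := 1) (by norm_num)).differentiable (by norm_num)
    exact this.clm_apply (differentiable_const _)
  have e : (fun y => fderiv ℝ (fun y => h (μ • y + ξ)) y (EuclideanSpace.single i 1)) =
      fun y => μ • (fun y => (fun y => fderiv ℝ h y (EuclideanSpace.single i 1)) (μ • y + ξ)) y := by
    funext y
    rw [fderiv_scale ξ hd]; rfl
  have hd3 : Differentiable ℝ (fun y : E3 => (fun y => fderiv ℝ h y (EuclideanSpace.single i 1)) (μ • y + ξ)) :=
    hd2.comp ((differentiable_id.const_smul μ).add_const ξ)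
  rw [e, fderiv_fun_const_smul (hd3 x), fderiv_scale ξ hd2]
  simp only [smul_apply, smul_eq_mul]
  ring

lemma back_scale (hμ : 0 < μ) (ξ : E3) (a : ℝ) (b : E3) (x : E3) :
    rho (μ⁻¹ • (x - ξ)) * sg a b (μ⁻¹ • (x - ξ)) =
      (2 * μ ^ 2 / ((3:ℝ) ^ ((1:ℝ)/4) * μ ^ ((1:ℝ)/2)) * b 0) * dBubbleXi μ ξ 0 x
      + (2 * μ ^ 2 / ((3:ℝ) ^ ((1:ℝ)/4) * μ ^ ((1:ℝ)/2)) * b 1) * dBubbleXi μ ξ 1 x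
      + (2 * μ ^ 2 / ((3:ℝ) ^ ((1:ℝ)/4) * μ ^ ((1:ℝ)/2)) * b 2) * dBubbleXi μ ξ 2 x
      + (2 * a * μ / ((3:ℝ) ^ ((1:ℝ)/4) * μ ^ (-(1:ℝ)/2))) * dBubbleMu μ ξ x := by
  set z := μ⁻¹ • (x - ξ) with hz
  have hx : x - ξ = μ • z := by rw [hz, smul_smul, mul_inv_cancel₀ hμ.ne', one_smul]
  have hc : ∀ i, x i - ξ i = μ * z i := fun i => by
    have := congrArg (fun v : E3 => v i) hx
    simpa using this
  have h0 : (0:ℝ) < 1 + ‖z‖ ^ 2 := by positivity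
  have hS : (μ ^ 2 + ‖x - ξ‖ ^ 2) ^ (-(3:ℝ)/2) = (μ ^ 3)⁻¹ * rho z ^ 3 := by
    have e : μ ^ 2 + ‖x - ξ‖ ^ 2 = μ ^ 2 * (1 + ‖z‖ ^ 2) := by
      rw [hx, norm_smul, Real.norm_eq_abs, abs_of_pos hμ]; ring
    rw [e, Real.mul_rpow (by positivity) h0.le, ← rho_rpow 3 z, ← Real.rpow_natCast μ 2,
      ← Real.rpow_mul hμ.le]
    norm_num
    try rw [Real.rpow_neg hμ.le]
    try norm_cast
  have hn : ‖x - ξ‖ ^ 2 = μ ^ 2 * ‖z‖ ^ 2 := by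
    rw [hx, norm_smul, Real.norm_eq_abs, abs_of_pos hμ]; ring
  have h3 : (3:ℝ) ^ ((1:ℝ)/4) ≠ 0 := by positivity
  have hm : μ ^ ((1:ℝ)/2) ≠ 0 := by positivity
  have hm' : μ ^ (-(1:ℝ)/2) ≠ 0 := by positivity
  simp only [dBubbleXi, dBubbleMu, hS]
  simp only [hc, hn]
  have hr := rho_sq_mul z
  have hin : inner ℝ b z = b 0 * z 0 + b 1 * z 1 + b 2 * z 2 := by
    simp [PiLp.inner_apply, Fin.sum_univ_three]; ring
  rw [sg, hin]
  field_simp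
  linear_combination (-a * rho z) * hr

end reduction

theorem main9 (α : ℝ) (hα : α ∈ Set.Ioo (0 : ℝ) 3)
    (μ : ℝ) (hμ : 0 < μ) (ξ : E3) (A : ℝ) (hA : 0 < A)
    (hAeq : ∀ x : E3,
      A * (∫ y : E3, (bubble μ ξ y) ^ (6 - α) / ‖x - y‖ ^ α) * (bubble μ ξ x) ^ (5 - α)
        = (bubble μ ξ x) ^ 5)
    (h : E3 → ℝ) (hreg : ContDiff ℝ 2 h)
    (hfin : MeasureTheory.Integrable (fun x : E3 => ‖fderiv ℝ h x‖ ^ 2))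
    (heq : ∀ x : E3, -(lap h x) =
      A * (6 - α) * (∫ y : E3, (bubble μ ξ y) ^ (5 - α) * h y / ‖x - y‖ ^ α)
          * (bubble μ ξ x) ^ (5 - α)
      + A * (5 - α) * (∫ y : E3, (bubble μ ξ y) ^ (6 - α) / ‖x - y‖ ^ α)
          * (bubble μ ξ x) ^ (4 - α) * h x) :
    ∃ c₀ c₁ c₂ c₃ : ℝ, ∀ x : E3,
      h x = c₁ * dBubbleXi μ ξ 0 x + c₂ * dBubbleXi μ ξ 1 x + c₃ * dBubbleXi μ ξ 2 x
        + c₀ * dBubbleMu μ ξ x := by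
  have hsc := bubble_scale hμ ξ
  have hk4 : μ ^ 2 * ((3:ℝ) ^ ((1:ℝ)/4) * μ ^ (-(1:ℝ)/2)) ^ 4 = 3 := by
    rw [mul_pow, ← Real.rpow_natCast ((3:ℝ) ^ ((1:ℝ)/4)), ← Real.rpow_natCast (μ ^ (-(1:ℝ)/2)),
      ← Real.rpow_mul (by norm_num), ← Real.rpow_mul hμ.le]
    norm_num
    field_simp
  have hk : 0 < (3:ℝ) ^ ((1:ℝ)/4) * μ ^ (-(1:ℝ)/2) := by positivity
  set κ : ℝ := (3:ℝ) ^ ((1:ℝ)/4) * μ ^ (-(1:ℝ)/2) with hκ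
  have hbpos : ∀ x, 0 < bubble μ ξ (μ • x + ξ) := fun x => by
    rw [hsc]; exact mul_pos hk (rho_pos x)
  have hAI : ∀ x : E3, A * (∫ y : E3, (bubble μ ξ y) ^ (6 - α) / ‖μ • x + ξ - y‖ ^ α)
      = bubble μ ξ (μ • x + ξ) ^ α := by
    intro x
    have h1 := hAeq (μ • x + ξ)
    have h2 : bubble μ ξ (μ • x + ξ) ^ 5 =
        bubble μ ξ (μ • x + ξ) ^ α * bubble μ ξ (μ • x + ξ) ^ (5 - α) := by
      rw [← Real.rpow_add (hbpos x), ← Real.rpow_natCast]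
      congr 1
      push_cast; ring
    rw [h2] at h1
    exact mul_right_cancel₀ (Real.rpow_pos_of_pos (hbpos x) _).ne' h1
  have hbr : ∀ (s : ℝ) (x : E3), bubble μ ξ (μ • x + ξ) ^ s = κ ^ s * rho x ^ s := fun s x => by
    rw [hsc, Real.mul_rpow hk.le (rho_pos x).le]
  have hB : ∀ x : E3, (A * μ ^ (3 - α) * κ ^ (6 - 2 * α)) *
      ∫ y : E3, rho y ^ (6 - α) / ‖x - y‖ ^ α = rho x ^ α := by
    intro x
    have h1 := hAI x
    rw [integral_scale hμ ξ x α (fun y => bubble μ ξ y ^ (6 - α))] at h1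
    simp only [hbr, mul_div_assoc] at h1
    rw [integral_const_mul] at h1
    have h2 : κ ^ (6 - α) = κ ^ α * κ ^ (6 - 2 * α) := by
      rw [← Real.rpow_add hk]; congr 1; ring
    rw [h2] at h1
    have h3 := (Real.rpow_pos_of_pos hk α).ne'
    apply mul_left_cancel₀ h3
    linear_combination h1
  have hd : Differentiable ℝ h := hreg.differentiable (by norm_num)
  obtain ⟨a, b, hab⟩ := core hα (B := A * μ ^ (3 - α) * κ ^ (6 - 2 * α)) (by positivity) hB
    (h := fun y => h (μ • y + ξ))
    (hreg.comp ((contDiff_id.const_smul μ).add contDiff_const))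
    (by
      have h1 := ((hfin.comp_add_right ξ).comp_smul hμ.ne').const_mul (μ ^ 2)
      refine h1.congr (Eventually.of_forall fun x => ?_)
      simp only [fderiv_scale ξ hd, norm_smul, Real.norm_eq_abs, mul_pow, sq_abs])
    (by
      intro x
      rw [lap_scale ξ hreg]
      have h1 := heq (μ • x + ξ)
      have h2 := hAI x
      rw [integral_scale hμ ξ x α (fun y => bubble μ ξ y ^ (5 - α) * h y)] at h1
      have h3 : (∫ z : E3, bubble μ ξ (μ • z + ξ) ^ (5 - α) * h (μ • z + ξ) / ‖x - z‖ ^ α) =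
          κ ^ (5 - α) * ∫ z : E3, rho z ^ (5 - α) * h (μ • z + ξ) / ‖x - z‖ ^ α := by
        rw [← integral_const_mul]
        refine integral_congr_ae (Eventually.of_forall fun z => ?_)
        simp only [hbr]
        ring
      rw [h3, hbr (5 - α) x] at h1
      have h4 : bubble μ ξ (μ • x + ξ) ^ α * bubble μ ξ (μ • x + ξ) ^ (4 - α) = κ ^ 4 * rho x ^ 4 := by
        rw [← Real.rpow_add (hbpos x), ← mul_pow, ← hsc, ← Real.rpow_natCast]
        congr 1
        push_cast; ring
      have h5 : κ ^ (5 - α) * κ ^ (5 - α) = κ ^ 4 * κ ^ (6 - 2 * α) := by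
        rw [← Real.rpow_add hk, ← Real.rpow_natCast κ 4, ← Real.rpow_add hk]
        congr 1
        push_cast; ring
      set J := ∫ z : E3, rho z ^ (5 - α) * h (μ • z + ξ) / ‖x - z‖ ^ α
      set I := ∫ y : E3, (bubble μ ξ y) ^ (6 - α) / ‖μ • x + ξ - y‖ ^ α
      set w4 := bubble μ ξ (μ • x + ξ) ^ (4 - α)
      linear_combination μ ^ 2 * h1 + μ ^ 2 * (5 - α) * w4 * h (μ • x + ξ) * h2
        + μ ^ 2 * (5 - α) * h (μ • x + ξ) * h4
        + μ ^ 2 * A * (6 - α) * μ ^ (3 - α) * J * rho x ^ (5 - α) * h5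
        + ((6 - α) * (A * μ ^ (3 - α) * κ ^ (6 - 2 * α)) * J * rho x ^ (5 - α)
          + (5 - α) * rho x ^ 4 * h (μ • x + ξ)) * hk4)
  have hfinal : ∀ x : E3, h x =
      (2 * μ ^ 2 / ((3:ℝ) ^ ((1:ℝ)/4) * μ ^ ((1:ℝ)/2)) * b 0) * dBubbleXi μ ξ 0 x
      + (2 * μ ^ 2 / ((3:ℝ) ^ ((1:ℝ)/4) * μ ^ ((1:ℝ)/2)) * b 1) * dBubbleXi μ ξ 1 x
      + (2 * μ ^ 2 / ((3:ℝ) ^ ((1:ℝ)/4) * μ ^ ((1:ℝ)/2)) * b 2) * dBubbleXi μ ξ 2 x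
      + (2 * a * μ / ((3:ℝ) ^ ((1:ℝ)/4) * μ ^ (-(1:ℝ)/2))) * dBubbleMu μ ξ x := by
    intro x
    have h1 := hab (μ⁻¹ • (x - ξ))
    rw [back_scale hμ ξ a b x] at h1
    have h2 : μ • μ⁻¹ • (x - ξ) + ξ = x := by
      rw [smul_smul, mul_inv_cancel₀ hμ.ne', one_smul, sub_add_cancel]
    simp only [h2] at h1
    exact h1
  exact ⟨_, _, _, _, hfinal⟩

end part9

/-- non-degeneracy of the bubble for the critical Choquard equation. Any finite
energy classical solution `h` of the linearized equation is a linear combination of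
`∂w_{μ,ξ}/∂ξ₁, ∂w_{μ,ξ}/∂ξ₂, ∂w_{μ,ξ}/∂ξ₃, ∂w_{μ,ξ}/∂μ`. -/
theorem bubble_nondegeneracy (α : ℝ) (hα : α ∈ Set.Ioo (0 : ℝ) 3)
    (μ : ℝ) (hμ : 0 < μ) (ξ : E3) (A : ℝ) (hA : 0 < A)
    (hAeq : ∀ x : E3,
      A * (∫ y : E3, (bubble μ ξ y) ^ (6 - α) / ‖x - y‖ ^ α) * (bubble μ ξ x) ^ (5 - α)
        = (bubble μ ξ x) ^ 5)
    (h : E3 → ℝ) (hreg : ContDiff ℝ 2 h)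
    (hfin : MeasureTheory.Integrable (fun x : E3 => ‖fderiv ℝ h x‖ ^ 2))
    (heq : ∀ x : E3, -(lap h x) =
      A * (6 - α) * (∫ y : E3, (bubble μ ξ y) ^ (5 - α) * h y / ‖x - y‖ ^ α)
          * (bubble μ ξ x) ^ (5 - α)
      + A * (5 - α) * (∫ y : E3, (bubble μ ξ y) ^ (6 - α) / ‖x - y‖ ^ α)
          * (bubble μ ξ x) ^ (4 - α) * h x) :
    ∃ c₀ c₁ c₂ c₃ : ℝ, ∀ x : E3,
      h x = c₁ * dBubbleXi μ ξ 0 x + c₂ * dBubbleXi μ ξ 1 x + c₃ * dBubbleXi μ ξ 2 x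
        + c₀ * dBubbleMu μ ξ x := by
  exact main9 α hα μ hμ ξ A hA hAeq h hreg hfin heq

end
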